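/- arXiv:2206.00514 — 2 statements merged into one kernel-verified Lean document; each statement's English description precedes it below -/
import Mathlib

section
/- Under Assumption (A) (p/n → γ ∈ (0,1)) and assuming C^{−1} ≤ A_{kk}² ≤ C for all k for a constant C ≥ 1 independent of n, the maximum max_{i = 0,…,p−1} |Z̃_{i+1}| converges to 0 in probability as n → ∞. -/
open MeasureTheory ProbabilityTheory Matrix Filter Topology

noncomputable section

/-- The standard Gaussian measure on `ℝ^d` (modeled on `Fin d → ℝ`). -/
def gaussianPi (d : ℕ) : Measure (Fin d → ℝ) :=
  Measure.pi fun _ => gaussianReal 0 1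

/-- The Euclidean norm on `Fin n → ℝ`. -/
def euclidNorm {n : ℕ} (x : Fin n → ℝ) : ℝ :=
  Real.sqrt (∑ j, x j ^ 2)

/-- The uniform distribution on the unit sphere `S^{n-1} ⊆ ℝ^n`, realized as the law of a
normalized standard Gaussian vector. -/
def uniformSphere (n : ℕ) : Measure (Fin n → ℝ) :=
  (gaussianPi n).map fun x => (euclidNorm x)⁻¹ • x

/-- The joint law of `p` independent uniform random directions `u_1, …, u_p` on `S^{n-1}`. -/
def sphereLaw (n p : ℕ) : Measure (Fin p → Fin n → ℝ) :=
  Measure.pi fun _ => uniformSphere n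

/-- The `(i+1)`-st sample vector `u_{i+1}` (junk value `0` if `i ≥ p`). -/
def uVec {n p : ℕ} (ω : Fin p → Fin n → ℝ) (i : ℕ) : Fin n → ℝ :=
  if h : i < p then ω ⟨i, h⟩ else 0

/-- The matrix `B_{(i)} = (b_1, …, b_i)ᵀ` with rows `b_j = A u_j`. -/
def rowMat {n p : ℕ} (A : Matrix (Fin n) (Fin n) ℝ) (ω : Fin p → Fin n → ℝ) (i : ℕ) :
    Matrix (Fin i) (Fin n) ℝ :=
  Matrix.of fun k j => A.mulVec (uVec ω (k : ℕ)) j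

/-- The projection matrix `P_i = I_n − B_{(i)}ᵀ (B_{(i)} B_{(i)}ᵀ)⁻¹ B_{(i)}` (with `P_0 = I_n`). -/
def projMat {n p : ℕ} (A : Matrix (Fin n) (Fin n) ℝ) (ω : Fin p → Fin n → ℝ) (i : ℕ) :
    Matrix (Fin n) (Fin n) ℝ :=
  1 - (rowMat A ω i)ᵀ * (rowMat A ω i * (rowMat A ω i)ᵀ)⁻¹ * rowMat A ω i

/-- The entrywise expectation `E[P_i]` of the projection matrix `P_i`. -/
def meanProj (n p : ℕ) (A : Matrix (Fin n) (Fin n) ℝ) (i : ℕ) :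
    Matrix (Fin n) (Fin n) ℝ :=
  Matrix.of fun k l => ∫ ω, projMat A ω i k l ∂(sphereLaw n p)

/-- `T_i = tr(A² E[P_i])`. -/
def Tstat (n p : ℕ) (A : Matrix (Fin n) (Fin n) ℝ) (i : ℕ) : ℝ :=
  Matrix.trace (A * A * meanProj n p A i)

/-- `Q_i = A P_i A / T_i`. -/
def Qmat {n p : ℕ} (A : Matrix (Fin n) (Fin n) ℝ) (ω : Fin p → Fin n → ℝ) (i : ℕ) :
    Matrix (Fin n) (Fin n) ℝ :=
  (Tstat n p A i)⁻¹ • (A * projMat A ω i * A)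

/-- `Z̃_{i+1} = n u_{i+1}ᵀ Q_i u_{i+1} − 1`. -/
def Ztil {n p : ℕ} (A : Matrix (Fin n) (Fin n) ℝ) (ω : Fin p → Fin n → ℝ) (i : ℕ) : ℝ :=
  (n : ℝ) * (uVec ω i ⬝ᵥ (Qmat A ω i).mulVec (uVec ω i)) - 1

/-- The variance `Var(f) = E[(f − E f)²]` of a real random variable `f` under `μ`. -/
def varInt {α : Type*} [MeasurableSpace α] (μ : Measure α) (f : α → ℝ) : ℝ :=
  ∫ ω, (f ω - ∫ ω', f ω' ∂μ) ^ 2 ∂μ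

end


section QuadTail

lemma integral_exp_sq_gaussian {s : ℝ} (hs : |s| ≤ 1 / 4) :
    Integrable (fun y : ℝ => Real.exp (s * y ^ 2)) (gaussianReal 0 1) ∧
    ∫ y, Real.exp (s * y ^ 2) ∂(gaussianReal 0 1) ≤ Real.exp (s + 4 * s ^ 2) := by
  have hs' := abs_le.1 hs
  have hb : 0 < 1 / 2 - s := by linarith [hs'.2]
  have hv : (1 : NNReal) ≠ 0 := one_ne_zero
  have key : ∀ y : ℝ, gaussianPDFReal 0 1 y * Real.exp (s * y ^ 2)
      = (√(2 * Real.pi))⁻¹ * Real.exp (-(1 / 2 - s) * y ^ 2) := by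
    intro y
    simp only [gaussianPDFReal, NNReal.coe_one, mul_one, sub_zero]
    rw [mul_assoc, ← Real.exp_add]
    congr 2
    ring
  constructor
  · rw [gaussianReal_of_var_ne_zero _ hv]
    rw [integrable_withDensity_iff_integrable_smul₀' (by fun_prop) (by simp [gaussianPDF])]
    have : (fun y : ℝ => (gaussianPDF 0 1 y).toReal • Real.exp (s * y ^ 2))
        = fun y => (√(2 * Real.pi))⁻¹ * Real.exp (-(1 / 2 - s) * y ^ 2) := by
      ext y
      rw [smul_eq_mul, ← key, toReal_gaussianPDF]
    rw [this]
    exact (integrable_exp_neg_mul_sq hb).const_mul _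
  · rw [integral_gaussianReal_eq_integral_smul hv]
    simp_rw [smul_eq_mul, key]
    rw [integral_const_mul, integral_gaussian]
    have h1 : (√(2 * Real.pi))⁻¹ * √(Real.pi / (1 / 2 - s)) = √((1 - 2 * s)⁻¹) := by
      rw [← Real.sqrt_inv, ← Real.sqrt_mul (by positivity)]
      congr 1
      have : (1 - 2 * s) ≠ 0 := by linarith
      have := Real.pi_pos.ne'
      field_simp
    rw [h1]
    have hpos : 0 < 1 - 2 * s := by linarith
    rw [Real.sqrt_le_left (Real.exp_pos _).le, ← Real.exp_nat_mul]
    rw [← Real.exp_log (inv_pos.2 hpos), Real.exp_le_exp, Real.log_inv]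
    have h2 := Real.abs_log_sub_add_sum_range_le (x := 2 * s) (by
      rw [abs_lt]; constructor <;> linarith) 1
    simp at h2
    have h3 : |2 * s| ≤ 1 / 2 := by rw [abs_mul]; norm_num; linarith
    have h4 : 2 ^ 2 * s ^ 2 / (1 - 2 * |s|) ≤ 8 * s ^ 2 := by
      rw [div_le_iff₀ (by linarith)]
      nlinarith [sq_nonneg s]
    have h5 := (abs_le.1 h2).1
    have h6 : (2 * |s|) ^ 2 = 2 ^ 2 * s ^ 2 := by rw [mul_pow, sq_abs]
    push_cast
    rw [h6] at h5
    linarith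

lemma quad_tail {n : ℕ} (N : Matrix (Fin n) (Fin n) ℝ) (hN : N.IsHermitian) {K η s : ℝ}
    (hK : ∀ x : Fin n → ℝ, |x ⬝ᵥ N *ᵥ x| ≤ K * (x ⬝ᵥ x))
    (htr : N.trace ≤ -(η * n)) (hs : 0 < s) (hsK : s * K ≤ 1 / 4) (hsη : 8 * s * K ^ 2 ≤ η) :
    gaussianPi n {x | 0 < x ⬝ᵥ N *ᵥ x} ≤ ENNReal.ofReal (Real.exp (-(s * η / 2) * n)) := by
  set b := hN.eigenvectorBasis with hb
  set ν := hN.eigenvalues with hν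
  -- eigenvalue bound
  have hνK : ∀ k, |ν k| ≤ K := by
    intro k
    have h := hK ((b k).ofLp)
    have h1 : N *ᵥ (b k).ofLp = ν k • (b k).ofLp := hN.mulVec_eigenvectorBasis k
    have h2 : (b k).ofLp ⬝ᵥ (b k).ofLp = 1 := by
      have := b.orthonormal.1 k
      have h3 := real_inner_self_eq_norm_sq (b k)
      rw [this] at h3
      simp only [PiLp.inner_apply, RCLike.inner_apply, conj_trivial] at h3
      simpa [dotProduct] using h3
    rw [h1, dotProduct_smul, h2] at h
    simpa using h
  have hquad : ∀ y : Fin n → ℝ, (∑ i, y i • b i).ofLp ⬝ᵥ N *ᵥ (∑ i, y i • b i).ofLp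
      = ∑ i, ν i * y i ^ 2 := by
    intro y
    have h1 : N *ᵥ (∑ i, y i • b i).ofLp = (∑ i, (ν i * y i) • b i).ofLp := by
      have : N *ᵥ (∑ i, y i • b i).ofLp = Matrix.toLin' N (∑ i, y i • (b i).ofLp) := by
        simp only [Matrix.toLin'_apply, WithLp.ofLp_sum, WithLp.ofLp_smul]
      rw [this, map_sum]
      simp only [map_smul, Matrix.toLin'_apply, WithLp.ofLp_sum, WithLp.ofLp_smul]
      refine Finset.sum_congr rfl fun i _ => ?_
      have h1 : N *ᵥ (b i).ofLp = ν i • (b i).ofLp := hN.mulVec_eigenvectorBasis i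
      rw [h1, smul_smul, mul_comm]
    rw [h1]
    have h2 : (∑ i, y i • b i).ofLp ⬝ᵥ (∑ i, (ν i * y i) • b i).ofLp
        = inner ℝ (∑ i, (ν i * y i) • b i) (∑ i, y i • b i) := by
      rw [EuclideanSpace.inner_eq_star_dotProduct]
      simp
    rw [h2, b.orthonormal.inner_sum]
    simp only [conj_trivial]
    exact Finset.sum_congr rfl fun i _ => by ring
  have hmeasS : MeasurableSet {x : Fin n → ℝ | 0 < x ⬝ᵥ N *ᵥ x} := by
    apply measurableSet_lt measurable_const
    exact Continuous.measurable (by fun_prop)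
  have hmeasT : MeasurableSet {x : EuclideanSpace ℝ (Fin n) | 0 < x.ofLp ⬝ᵥ N *ᵥ x.ofLp} := by
    apply measurableSet_lt measurable_const
    exact Continuous.measurable (by fun_prop)
  have e1 : gaussianPi n {x | 0 < x ⬝ᵥ N *ᵥ x}
      = gaussianPi n {y | 0 < ∑ i, ν i * y i ^ 2} := by
    have h1 : gaussianPi n {x | 0 < x ⬝ᵥ N *ᵥ x}
        = stdGaussian (EuclideanSpace ℝ (Fin n)) {x | 0 < x.ofLp ⬝ᵥ N *ᵥ x.ofLp} := by
      rw [← map_pi_eq_stdGaussian, Measure.map_apply (by fun_prop) hmeasT]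
      rfl
    rw [h1, stdGaussian_eq_map_pi_orthonormalBasis b, Measure.map_apply (by fun_prop) hmeasT]
    simp only [Set.preimage_ofPred_eq]
    simp_rw [hquad]
    rfl
  rw [e1]
  have hprob : IsProbabilityMeasure (gaussianPi n) := by unfold gaussianPi; infer_instance
  have hK' : ∀ k, |s * ν k| ≤ 1 / 4 := by
    intro k
    rw [abs_mul, abs_of_pos hs]
    exact le_trans (mul_le_mul_of_nonneg_left (hνK k) hs.le) hsK
  have hIntg : Integrable (fun y : Fin n → ℝ => ∏ i, Real.exp (s * ν i * y i ^ 2)) (gaussianPi n) :=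
    Integrable.fintype_prod (f := fun i y => Real.exp (s * ν i * y ^ 2))
      (fun i => (integral_exp_sq_gaussian (hK' i)).1)
  have hI : ∫ y : Fin n → ℝ, ∏ i, Real.exp (s * ν i * y i ^ 2) ∂(gaussianPi n)
      ≤ Real.exp (-(s * η / 2) * n) := by
    unfold gaussianPi
    rw [integral_fintype_prod_eq_prod (f := fun i y => Real.exp (s * ν i * y ^ 2))]
    calc _ ≤ ∏ i, Real.exp (s * ν i + 4 * (s * ν i) ^ 2) :=
          Finset.prod_le_prod (fun i _ => integral_nonneg fun y => (Real.exp_pos _).le)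
            (fun i _ => (integral_exp_sq_gaussian (hK' i)).2)
      _ = Real.exp (∑ i, (s * ν i + 4 * (s * ν i) ^ 2)) := (Real.exp_sum _ _).symm
      _ ≤ _ := by
        apply Real.exp_le_exp.2
        rw [Finset.sum_add_distrib, ← Finset.mul_sum]
        have ht : N.trace = ∑ i, ν i := by simpa using hN.trace_eq_sum_eigenvalues
        have hsq : ∑ i, 4 * (s * ν i) ^ 2 ≤ ∑ _i : Fin n, (s * η / 2) := by
          refine Finset.sum_le_sum fun i _ => ?_
          have : ν i ^ 2 ≤ K ^ 2 := by
            rw [← sq_abs (ν i)]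
            exact pow_le_pow_left₀ (abs_nonneg _) (hνK i) 2
          nlinarith [mul_le_mul_of_nonneg_left this (sq_nonneg s),
            mul_le_mul_of_nonneg_left hsη hs.le]
        simp only [Finset.sum_const, Finset.card_univ, Fintype.card_fin, nsmul_eq_mul] at hsq
        rw [ht] at htr
        nlinarith [mul_le_mul_of_nonneg_left htr hs.le]
  have hmk := mul_meas_ge_le_integral_of_nonneg (μ := gaussianPi n)
    (Filter.Eventually.of_forall fun y => Finset.prod_nonneg fun i _ => (Real.exp_pos _).le) hIntg 1
  rw [one_mul] at hmk
  have hsub : {y : Fin n → ℝ | 0 < ∑ i, ν i * y i ^ 2}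
      ⊆ {y | 1 ≤ ∏ i, Real.exp (s * ν i * y i ^ 2)} := by
    intro y hy
    simp only [Set.mem_ofPred_eq] at hy ⊢
    rw [← Real.exp_sum, Real.one_le_exp_iff]
    simp_rw [mul_assoc]
    rw [← Finset.mul_sum]
    positivity
  refine (measure_mono hsub).trans ?_
  rw [← ofReal_measureReal]
  exact ENNReal.ofReal_le_ofReal (hmk.trans hI)

end QuadTail

section McDiarmid

lemma integrable_of_bdd {α : Type*} [MeasurableSpace α] (μ : Measure α) [IsFiniteMeasure μ]
    {f : α → ℝ} (hf : Measurable f) {K : ℝ} (hK : ∀ x, |f x| ≤ K) : Integrable f μ :=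
  Integrable.of_bound hf.aestronglyMeasurable K (Filter.Eventually.of_forall hK)

lemma mcdiarmid_mgf {E : Type*} [MeasurableSpace E] (μ : Measure E) [IsProbabilityMeasure μ]
    (c K t : ℝ) : ∀ (m : ℕ) (f : (Fin m → E) → ℝ), Measurable f → (∀ ω, |f ω| ≤ K) →
    (∀ ω j x, |f ω - f (Function.update ω j x)| ≤ c) →
    ∫ ω, Real.exp (t * (f ω - ∫ ω', f ω' ∂(Measure.pi fun _ => μ))) ∂(Measure.pi fun _ => μ)
      ≤ Real.exp (m * (c ^ 2 * t ^ 2 / 2)) := by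
  intro m
  induction m with
  | zero =>
    intro f hf hK hc
    have : ∀ ω : Fin 0 → E, f ω = f (fun i => i.elim0) := fun ω => by
      congr 1; ext i; exact i.elim0
    simp [this]
  | succ m ih =>
    intro f hf hK hc
    have hmp := (measurePreserving_piFinSuccAbove (fun _ : Fin (m + 1) => μ) 0).symm
    have hsy : ∀ z : E × (Fin m → E), (MeasurableEquiv.piFinSuccAbove (fun _ : Fin (m + 1) => E) 0).symm z
        = Fin.cons z.1 z.2 := by
      intro z
      exact Fin.insertNth_zero' z.1 z.2
    have hI : ∀ g : (Fin (m + 1) → E) → ℝ, ∫ ω, g ω ∂(Measure.pi fun _ => μ)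
        = ∫ z, g (Fin.cons z.1 z.2) ∂(μ.prod (Measure.pi fun _ : Fin m => μ)) := by
      intro g
      rw [← hmp.integral_comp']
      simp_rw [hsy]
    have hcm : Measurable (fun z : E × (Fin m → E) => (Fin.cons z.1 z.2 : Fin (m + 1) → E)) := by
      have := hmp.measurable
      simpa only [funext hsy] using this
    have hfm : Measurable (fun z : E × (Fin m → E) => f (Fin.cons z.1 z.2)) := hf.comp hcm
    have hcx : ∀ x, Measurable (fun w : Fin m → E => f (Fin.cons x w)) := fun x =>
      hfm.comp measurable_prodMk_left
    have hfint : Integrable (fun z : E × (Fin m → E) => f (Fin.cons z.1 z.2))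
        (μ.prod (Measure.pi fun _ : Fin m => μ)) := integrable_of_bdd _ hfm (fun z => hK _)
    set g : E → ℝ := fun x => ∫ w, f (Fin.cons x w) ∂(Measure.pi fun _ : Fin m => μ) with hg
    have hgm : Measurable g := by
      have := hfm.stronglyMeasurable.integral_prod_right' (ν := Measure.pi fun _ : Fin m => μ)
      exact this.measurable
    have hgK : ∀ x, |g x| ≤ K := by
      intro x
      have := norm_integral_le_of_norm_le_const (μ := Measure.pi fun _ : Fin m => μ)
        (f := fun w => f (Fin.cons x w)) (C := K) (Filter.Eventually.of_forall fun w => hK _)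
      simpa using this
    have hgc : ∀ x x', |g x - g x'| ≤ c := by
      intro x x'
      rw [hg]
      simp only
      rw [← integral_sub (integrable_of_bdd _ (hcx x) fun w => hK _)
        (integrable_of_bdd _ (hcx x') fun w => hK _)]
      have := norm_integral_le_of_norm_le_const (μ := Measure.pi fun _ : Fin m => μ)
        (f := fun w => f (Fin.cons x w) - f (Fin.cons x' w)) (C := c)
        (Filter.Eventually.of_forall fun w => by
          have := hc (Fin.cons x w) 0 x'
          rwa [Fin.update_cons_zero] at this)
      simpa using this
    have hF : ∫ ω, f ω ∂(Measure.pi fun _ : Fin (m + 1) => μ) = ∫ x, g x ∂μ := by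
      rw [hI, integral_prod _ hfint]
    rw [hF, hI]
    set G := ∫ x, g x ∂μ with hG
    have hexpm : Measurable (fun z : E × (Fin m → E) => Real.exp (t * (f (Fin.cons z.1 z.2) - G))) := by
      fun_prop
    have hexpint : Integrable (fun z : E × (Fin m → E) => Real.exp (t * (f (Fin.cons z.1 z.2) - G)))
        (μ.prod (Measure.pi fun _ : Fin m => μ)) := by
      refine integrable_of_bdd _ hexpm (K := Real.exp (|t| * (K + |G|))) (fun z => ?_)
      rw [Real.abs_exp]
      apply Real.exp_le_exp.2
      refine (le_abs_self _).trans ?_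
      rw [abs_mul]
      gcongr
      exact (abs_sub _ _).trans (by gcongr; exact hK _)
    rw [integral_prod _ hexpint]
    have hinner : ∀ x, ∫ w, Real.exp (t * (f (Fin.cons x w) - G)) ∂(Measure.pi fun _ : Fin m => μ)
        ≤ Real.exp (m * (c ^ 2 * t ^ 2 / 2)) * Real.exp (t * (g x - G)) := by
      intro x
      have := ih (fun w => f (Fin.cons x w)) (hcx x) (fun w => hK _) (fun w j y => by
        have := hc (Fin.cons x w) j.succ y
        rwa [← Fin.cons_update] at this)
      have h2 : ∀ w, Real.exp (t * (f (Fin.cons x w) - G))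
          = Real.exp (t * (f (Fin.cons x w) - g x)) * Real.exp (t * (g x - G)) := by
        intro w; rw [← Real.exp_add]; congr 1; ring
      simp_rw [h2]
      rw [integral_mul_const]
      exact mul_le_mul_of_nonneg_right this (Real.exp_pos _).le
    obtain ⟨x0⟩ : Nonempty E := μ.nonempty_of_neZero
    have hsub := hasSubgaussianMGF_of_mem_Icc (μ := μ) (X := g) (a := g x0 - c) (b := g x0 + c)
      hgm.aemeasurable (Filter.Eventually.of_forall fun x => by
        have := abs_le.1 (hgc x x0)
        constructor <;> linarith)
    have hmgf := hsub.mgf_le t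
    have hIntg2 := hsub.integrable_exp_mul t
    simp only [mgf] at hmgf
    have h3 : (((‖g x0 + c - (g x0 - c)‖₊ / 2) ^ 2 : NNReal) : ℝ) = c ^ 2 := by
      push_cast
      rw [Real.norm_eq_abs, div_pow, sq_abs]; ring
    rw [h3] at hmgf
    calc _ ≤ ∫ x, Real.exp (m * (c ^ 2 * t ^ 2 / 2)) * Real.exp (t * (g x - G)) ∂μ :=
          integral_mono hexpint.integral_prod_left (hIntg2.const_mul _) hinner
      _ = Real.exp (m * (c ^ 2 * t ^ 2 / 2)) * ∫ x, Real.exp (t * (g x - G)) ∂μ :=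
          integral_const_mul _ _
      _ ≤ Real.exp (m * (c ^ 2 * t ^ 2 / 2)) * Real.exp (c ^ 2 * t ^ 2 / 2) := by gcongr
      _ = _ := by rw [← Real.exp_add]; congr 1; push_cast; ring

end McDiarmid

section AE

lemma pi_slice_le {E : Type*} [MeasurableSpace E] (μ : Measure E) [IsProbabilityMeasure μ] {m : ℕ}
    (k : Fin m) {S : Set (Fin m → E)} (hSm : MeasurableSet S) (c : ENNReal)
    (h : ∀ ω : Fin m → E, μ {x | Function.update ω k x ∈ S} ≤ c) :
    (Measure.pi fun _ : Fin m => μ) S ≤ c := by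
  cases m with
  | zero => exact k.elim0
  | succ m =>
    have hmp := (measurePreserving_piFinSuccAbove (fun _ : Fin (m + 1) => μ) k).symm
    obtain ⟨x0⟩ : Nonempty E := μ.nonempty_of_neZero
    rw [← hmp.measure_preimage hSm.nullMeasurableSet, Measure.prod_apply_symm (hmp.measurable hSm)]
    calc _ ≤ ∫⁻ _y, c ∂(Measure.pi fun _ : Fin m => μ) := by
          refine lintegral_mono fun r => ?_
          refine le_trans (measure_mono ?_) (h (k.insertNth (α := fun _ => E) x0 r))
          intro x hx
          have hx' : (k.insertNth (α := fun _ => E) x r) ∈ S := hx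
          simp only [Set.mem_ofPred_eq]
          rwa [Fin.update_insertNth]
      _ = c := by simp

lemma gaussianPi_submodule {n : ℕ} (S : Submodule ℝ (Fin n → ℝ)) (hS : S ≠ ⊤) :
    gaussianPi n (S : Set (Fin n → ℝ)) = 0 := by
  obtain ⟨k, hk⟩ : ∃ k : Fin n, (Pi.single k (1 : ℝ) : Fin n → ℝ) ∉ S := by
    by_contra h
    push Not at h
    apply hS
    rw [Submodule.eq_top_iff']
    intro x
    have : x = ∑ i, x i • (Pi.single i (1 : ℝ) : Fin n → ℝ) := by
      ext j; simp [Pi.single_apply]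
    rw [this]
    exact S.sum_mem fun i _ => S.smul_mem _ (h i)
  have hSm : MeasurableSet (S : Set (Fin n → ℝ)) :=
    (Submodule.closed_of_finiteDimensional S).measurableSet
  rw [← nonpos_iff_eq_zero]
  refine pi_slice_le (gaussianReal 0 1) k hSm 0 fun ω => ?_
  rw [nonpos_iff_eq_zero]
  have hna := nullSingletonClass_gaussianReal (μ := 0) (one_ne_zero : (1 : NNReal) ≠ 0)
  apply Set.Subsingleton.measure_zero
  · intro x hx y hy
    by_contra hxy
    apply hk
    have h1 : Function.update ω k x - Function.update ω k y ∈ S := S.sub_mem hx hy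
    have h2 : (Pi.single k (1 : ℝ) : Fin n → ℝ)
        = (x - y)⁻¹ • (Function.update ω k x - Function.update ω k y) := by
      ext j
      by_cases hj : j = k
      · subst hj
        simp [inv_mul_cancel₀ (sub_ne_zero.2 hxy)]
      · simp [hj]
    rw [h2]
    exact S.smul_mem _ h1

instance {n : ℕ} : IsProbabilityMeasure (gaussianPi n) := by unfold gaussianPi; infer_instance

lemma measurable_normalize {n : ℕ} :
    Measurable (fun x : Fin n → ℝ => (euclidNorm x)⁻¹ • x) := by
  unfold euclidNorm
  fun_prop

instance {n : ℕ} : IsProbabilityMeasure (uniformSphere n) :=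
  Measure.isProbabilityMeasure_map measurable_normalize.aemeasurable

instance {n p : ℕ} : IsProbabilityMeasure (sphereLaw n p) := by unfold sphereLaw; infer_instance

lemma euclidNorm_pos {n : ℕ} {x : Fin n → ℝ} (hx : x ≠ 0) : 0 < euclidNorm x := by
  unfold euclidNorm
  apply Real.sqrt_pos.2
  obtain ⟨k, hk⟩ := Function.ne_iff.1 hx
  exact Finset.sum_pos' (fun i _ => sq_nonneg _) ⟨k, Finset.mem_univ _, by
    have : x k ≠ 0 := hk
    positivity⟩

lemma uniformSphere_submodule {n : ℕ} (S : Submodule ℝ (Fin n → ℝ)) (hS : S ≠ ⊤) :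
    uniformSphere n (S : Set (Fin n → ℝ)) = 0 := by
  have hSm : MeasurableSet (S : Set (Fin n → ℝ)) :=
    (Submodule.closed_of_finiteDimensional S).measurableSet
  unfold uniformSphere
  rw [Measure.map_apply measurable_normalize hSm]
  refine measure_mono_null ?_ (gaussianPi_submodule S hS)
  intro x hx
  by_cases h0 : x = 0
  · subst h0; exact S.zero_mem
  · have h1 : (euclidNorm x)⁻¹ • x ∈ S := hx
    have := S.smul_mem (euclidNorm x) h1
    rwa [smul_smul, mul_inv_cancel₀ (euclidNorm_pos h0).ne', one_smul] at this

lemma ae_linearIndependent {n : ℕ} : ∀ p : ℕ, p ≤ n →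
    ∀ᵐ ω ∂(sphereLaw n p), LinearIndependent ℝ ω := by
  intro p
  induction p with
  | zero => intro _; exact Filter.Eventually.of_forall fun ω => linearIndependent_empty_type
  | succ m ih =>
    intro hm
    have hmp := (measurePreserving_piFinSuccAbove (fun _ : Fin (m + 1) => uniformSphere n) 0).symm
    have hSm : MeasurableSet {ω : Fin (m + 1) → Fin n → ℝ | LinearIndependent ℝ ω}ᶜ :=
      isOpen_setOfPred_linearIndependent.measurableSet.compl
    rw [ae_iff]
    change sphereLaw n (m + 1) {ω : Fin (m + 1) → Fin n → ℝ | LinearIndependent ℝ ω}ᶜ = 0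
    unfold sphereLaw
    rw [← hmp.measure_preimage hSm.nullMeasurableSet, Measure.prod_apply_symm (hmp.measurable hSm)]
    refine lintegral_eq_zero_of_ae_eq_zero ?_
    filter_upwards [ih (by omega)] with r hr
    refine measure_mono_null ?_ (uniformSphere_submodule (Submodule.span ℝ (Set.range r)) ?_)
    · intro x hx
      have hx' : ¬ LinearIndependent ℝ (Fin.cons x r : Fin (m + 1) → Fin n → ℝ) := by
        have h1 := Fin.insertNth_zero' x r
        intro h2
        rw [← h1] at h2
        exact hx h2
      rw [linearIndependent_finCons] at hx'
      by_contra h3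
      exact hx' ⟨hr, h3⟩
    · intro htop
      have h1 := finrank_range_le_card (R := ℝ) r
      rw [Set.finrank, htop] at h1
      simp at h1
      omega

end AE

section LinAlg

/-- The projection attached to a row matrix. -/
noncomputable def prj {i n : ℕ} (B : Matrix (Fin i) (Fin n) ℝ) : Matrix (Fin n) (Fin n) ℝ :=
  1 - Bᵀ * (B * Bᵀ)⁻¹ * B

/-- The regularised projection. -/
noncomputable def rsv {i n : ℕ} (ε : ℝ) (B : Matrix (Fin i) (Fin n) ℝ) : Matrix (Fin n) (Fin n) ℝ :=
  1 - Bᵀ * (B * Bᵀ + ε • (1 : Matrix (Fin i) (Fin i) ℝ))⁻¹ * B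

variable {i n : ℕ}

lemma dot_self_nonneg (x : Fin n → ℝ) : 0 ≤ x ⬝ᵥ x :=
  Finset.sum_nonneg fun k _ => mul_self_nonneg (x k)

lemma prj_transpose (B : Matrix (Fin i) (Fin n) ℝ) : (prj B)ᵀ = prj B := by
  unfold prj
  rw [transpose_sub, transpose_mul, transpose_mul, transpose_nonsing_inv, transpose_mul,
    transpose_transpose, transpose_one, Matrix.mul_assoc]

lemma prj_mul_self (B : Matrix (Fin i) (Fin n) ℝ) : prj B * prj B = prj B := by
  by_cases h : IsUnit (B * Bᵀ).det
  · have h1 : B * prj B = 0 := by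
      unfold prj
      rw [Matrix.mul_sub, Matrix.mul_one, ← Matrix.mul_assoc, ← Matrix.mul_assoc,
        Matrix.mul_nonsing_inv _ h, Matrix.one_mul, sub_self]
    nth_rewrite 1 [prj]
    rw [Matrix.sub_mul, Matrix.one_mul, Matrix.mul_assoc, h1, Matrix.mul_zero, sub_zero]
  · unfold prj
    rw [Matrix.nonsing_inv_apply_not_isUnit _ h]
    simp

lemma prj_trace (B : Matrix (Fin i) (Fin n) ℝ) : (n : ℝ) - i ≤ (prj B).trace := by
  by_cases h : IsUnit (B * Bᵀ).det
  · unfold prj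
    rw [trace_sub, Matrix.mul_assoc, trace_mul_comm, Matrix.mul_assoc, Matrix.nonsing_inv_mul _ h]
    simp
  · unfold prj
    rw [Matrix.nonsing_inv_apply_not_isUnit _ h]
    simp

lemma prj_quad (B : Matrix (Fin i) (Fin n) ℝ) (x : Fin n → ℝ) :
    x ⬝ᵥ prj B *ᵥ x = (prj B *ᵥ x) ⬝ᵥ (prj B *ᵥ x) := by
  conv_lhs => rw [← prj_mul_self, ← Matrix.mulVec_mulVec, dotProduct_mulVec, ← mulVec_transpose,
    prj_transpose]

lemma prj_quad_nonneg (B : Matrix (Fin i) (Fin n) ℝ) (x : Fin n → ℝ) :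
    0 ≤ x ⬝ᵥ prj B *ᵥ x := by
  rw [prj_quad]
  exact dot_self_nonneg _

lemma prj_quad_le (B : Matrix (Fin i) (Fin n) ℝ) (x : Fin n → ℝ) :
    x ⬝ᵥ prj B *ᵥ x ≤ x ⬝ᵥ x := by
  have h := dot_self_nonneg (x - prj B *ᵥ x)
  rw [sub_dotProduct, dotProduct_sub, dotProduct_sub, ← prj_quad, dotProduct_comm (prj B *ᵥ x) x] at h
  linarith

lemma prj_diag (B : Matrix (Fin i) (Fin n) ℝ) (k : Fin n) : 0 ≤ prj B k k ∧ prj B k k ≤ 1 := by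
  have h1 := prj_quad_nonneg B (Pi.single k 1)
  have h2 := prj_quad_le B (Pi.single k 1)
  simp at h1 h2
  exact ⟨h1, h2⟩

lemma posDef_reg {m : ℕ} (B : Matrix (Fin m) (Fin i) ℝ) {ε : ℝ} (hε : 0 < ε) :
    (B * Bᵀ + ε • (1 : Matrix (Fin m) (Fin m) ℝ)).PosDef := by
  have h1 : (B * Bᵀ).PosSemidef := by
    simpa using Matrix.posSemidef_self_mul_conjTranspose B
  exact Matrix.PosDef.posSemidef_add h1 (Matrix.PosDef.one.smul hε)

lemma rsv_eq (B : Matrix (Fin i) (Fin n) ℝ) {ε : ℝ} (hε : 0 < ε) :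
    rsv ε B = ε • (Bᵀ * B + ε • (1 : Matrix (Fin n) (Fin n) ℝ))⁻¹ := by
  have hM : IsUnit (Bᵀ * B + ε • (1 : Matrix (Fin n) (Fin n) ℝ)).det := by
    have := (posDef_reg Bᵀ hε).det_pos
    rw [transpose_transpose] at this
    exact this.ne'.isUnit
  have hG : IsUnit (B * Bᵀ + ε • (1 : Matrix (Fin i) (Fin i) ℝ)).det :=
    (posDef_reg B hε).det_pos.ne'.isUnit
  set M := Bᵀ * B + ε • (1 : Matrix (Fin n) (Fin n) ℝ) with hMd
  set G := B * Bᵀ + ε • (1 : Matrix (Fin i) (Fin i) ℝ) with hGd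
  have h1 : M * Bᵀ = Bᵀ * G := by
    rw [hMd, hGd, Matrix.add_mul, Matrix.mul_add, Matrix.mul_assoc]
    simp
  have h2 : M * rsv ε B = ε • (1 : Matrix (Fin n) (Fin n) ℝ) := by
    unfold rsv
    rw [Matrix.mul_sub, Matrix.mul_one, ← hGd, ← Matrix.mul_assoc, ← Matrix.mul_assoc, h1,
      Matrix.mul_assoc Bᵀ, Matrix.mul_nonsing_inv _ hG, Matrix.mul_one, hMd]
    simp
  calc rsv ε B = M⁻¹ * (M * rsv ε B) := by
        rw [← Matrix.mul_assoc, Matrix.nonsing_inv_mul _ hM, Matrix.one_mul]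
    _ = _ := by rw [h2]; simp

lemma rsv_diag (B : Matrix (Fin i) (Fin n) ℝ) {ε : ℝ} (hε : 0 < ε) (k : Fin n) :
    0 ≤ rsv ε B k k ∧ rsv ε B k k ≤ 1 := by
  constructor
  · rw [rsv_eq B hε]
    have h1 := (posDef_reg Bᵀ hε).inv.diag_pos (i := k)
    rw [transpose_transpose] at h1
    rw [Matrix.smul_apply, smul_eq_mul]
    exact mul_nonneg hε.le h1.le
  · have h1 := ((posDef_reg B hε).inv.posSemidef.conjTranspose_mul_mul_same B).diag_nonneg (i := k)
    unfold rsv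
    rw [Matrix.sub_apply, Matrix.one_apply_eq]
    rw [conjTranspose_eq_transpose_of_trivial] at h1
    linarith

lemma row_decomp (B : Matrix (Fin i) (Fin n) ℝ) (j : Fin i) :
    Bᵀ * B = (B.updateRow j 0)ᵀ * (B.updateRow j 0) + vecMulVec (B j) (B j) := by
  ext k l
  simp only [Matrix.mul_apply, Matrix.transpose_apply, Matrix.add_apply, vecMulVec_apply]
  rw [← Finset.add_sum_erase _ _ (Finset.mem_univ j),
    ← Finset.add_sum_erase (a := j) _ (fun x => (B.updateRow j 0) x k * _) (Finset.mem_univ j)]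
  have : ∑ x ∈ Finset.univ.erase j, (B.updateRow j 0) x k * (B.updateRow j 0) x l
      = ∑ x ∈ Finset.univ.erase j, B x k * B x l := by
    refine Finset.sum_congr rfl fun x hx => ?_
    rw [Matrix.updateRow_ne (Finset.ne_of_mem_erase hx)]
  rw [this]
  simp [add_comm]

lemma rsv_row (B : Matrix (Fin i) (Fin n) ℝ) (j : Fin i) {ε C : ℝ} (hε : 0 < ε) (hC : 0 ≤ C)
    (d : Fin n → ℝ) (hd : ∀ k, 0 ≤ d k ∧ d k ≤ C) :
    ∑ k, d k * rsv ε B k k ≤ ∑ k, d k * rsv ε (B.updateRow j 0) k k ∧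
    ∑ k, d k * rsv ε (B.updateRow j 0) k k - C ≤ ∑ k, d k * rsv ε B k k := by
  set B0 := B.updateRow j 0 with hB0
  rw [rsv_eq B hε, rsv_eq B0 hε, row_decomp B j, ← hB0]
  have hpd : (B0ᵀ * B0 + ε • (1 : Matrix (Fin n) (Fin n) ℝ)).PosDef := by
    simpa using posDef_reg B0ᵀ hε
  set M := B0ᵀ * B0 + ε • (1 : Matrix (Fin n) (Fin n) ℝ) with hM
  have hMu : IsUnit M.det := hpd.det_pos.ne'.isUnit
  have hMt : Mᵀ = M := by simpa using hpd.isHermitian.eq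
  set b := B j
  set y := M⁻¹ *ᵥ b with hy
  have hMy : M *ᵥ y = b := by
    rw [hy, mulVec_mulVec, Matrix.mul_nonsing_inv _ hMu, one_mulVec]
  have hyy : ε * (y ⬝ᵥ y) ≤ b ⬝ᵥ y := by
    have h1 : b ⬝ᵥ y = (B0 *ᵥ y) ⬝ᵥ (B0 *ᵥ y) + ε * (y ⬝ᵥ y) := by
      rw [← hMy, hM, add_mulVec, add_dotProduct, smul_mulVec, one_mulVec, smul_dotProduct,
        ← mulVec_mulVec, smul_eq_mul, mulVec_transpose, ← dotProduct_mulVec]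
    have := dot_self_nonneg (B0 *ᵥ y)
    linarith
  have hyy0 : 0 ≤ y ⬝ᵥ y := dot_self_nonneg y
  have hby : 0 ≤ b ⬝ᵥ y := le_trans (by positivity) hyy
  set α := 1 + b ⬝ᵥ y with hα
  have hα0 : 0 < α := by linarith
  have hsum : B0ᵀ * B0 + vecMulVec b b + ε • (1 : Matrix (Fin n) (Fin n) ℝ) = M + vecMulVec b b := by
    rw [hM]; abel
  have hinv : (M + vecMulVec b b)⁻¹ = M⁻¹ - α⁻¹ • vecMulVec y y := by
    apply Matrix.inv_eq_right_inv
    have h1 : vecMulVec b b * M⁻¹ = vecMulVec b y := by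
      rw [vecMulVec_mul, hy, ← vecMul_transpose, transpose_nonsing_inv, hMt]
    have h2 : M * vecMulVec y y = vecMulVec b y := by
      rw [mul_vecMulVec, hMy]
    have h3 : vecMulVec b b * vecMulVec y y = (b ⬝ᵥ y) • vecMulVec b y := by
      rw [vecMulVec_mul_vecMulVec]
      ext k l; simp [vecMulVec_apply]; try ring
    rw [Matrix.mul_sub, Matrix.add_mul, Matrix.mul_nonsing_inv _ hMu, h1, Matrix.mul_smul,
      Matrix.add_mul, h2, h3]
    have : vecMulVec b y + (b ⬝ᵥ y) • vecMulVec b y = α • vecMulVec b y := by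
      rw [hα, add_smul, one_smul]
    rw [this, smul_smul, inv_mul_cancel₀ hα0.ne', one_smul, add_sub_cancel_right]
  rw [hsum, hinv]
  have hs : ∑ k, d k * (ε • (M⁻¹ - α⁻¹ • vecMulVec y y)) k k
      = ∑ k, d k * (ε • M⁻¹) k k - ε * α⁻¹ * ∑ k, d k * (y k * y k) := by
    rw [Finset.mul_sum, ← Finset.sum_sub_distrib]
    refine Finset.sum_congr rfl fun k _ => ?_
    simp [vecMulVec_apply]; ring
  rw [hs]
  have h0 : 0 ≤ ∑ k, d k * (y k * y k) :=
    Finset.sum_nonneg fun k _ => mul_nonneg (hd k).1 (mul_self_nonneg _)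
  have h1 : ∑ k, d k * (y k * y k) ≤ C * (y ⬝ᵥ y) := by
    rw [dotProduct, Finset.mul_sum]
    exact Finset.sum_le_sum fun k _ => mul_le_mul_of_nonneg_right (hd k).2 (mul_self_nonneg _)
  constructor
  · have : 0 ≤ ε * α⁻¹ * ∑ k, d k * (y k * y k) := by positivity
    linarith
  · have : ε * α⁻¹ * ∑ k, d k * (y k * y k) ≤ C := by
      rw [mul_comm ε, mul_assoc, inv_mul_le_iff₀ hα0]
      nlinarith [mul_le_mul_of_nonneg_left h1 hε.le, mul_le_mul_of_nonneg_left hyy hC]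
    linarith

lemma rsv_update (B : Matrix (Fin i) (Fin n) ℝ) (j : Fin i) (v : Fin n → ℝ) {ε C : ℝ} (hε : 0 < ε)
    (hC : 0 ≤ C) (d : Fin n → ℝ) (hd : ∀ k, 0 ≤ d k ∧ d k ≤ C) :
    |∑ k, d k * rsv ε B k k - ∑ k, d k * rsv ε (B.updateRow j v) k k| ≤ C := by
  have h1 := rsv_row B j hε hC d hd
  have h2 := rsv_row (B.updateRow j v) j hε hC d hd
  rw [Matrix.updateRow_idem] at h2
  rw [abs_le]
  constructor <;> linarith [h1.1, h1.2, h2.1, h2.2]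

lemma rsv_tendsto (B : Matrix (Fin i) (Fin n) ℝ) (h : (B * Bᵀ).det ≠ 0) (k : Fin n) :
    Tendsto (fun m : ℕ => rsv (1 / ((m : ℝ) + 1)) B k k) atTop (𝓝 (prj B k k)) := by
  have hc : ContinuousAt (fun ε : ℝ => rsv ε B k k) 0 := by
    have hG : Continuous fun ε : ℝ => B * Bᵀ + ε • (1 : Matrix (Fin i) (Fin i) ℝ) := by fun_prop
    have h1 : ContinuousAt (fun ε : ℝ => (B * Bᵀ + ε • (1 : Matrix (Fin i) (Fin i) ℝ))⁻¹) 0 := by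
      simp only [Matrix.inv_def, Ring.inverse_eq_inv']
      refine ContinuousAt.smul (ContinuousAt.inv₀ hG.matrix_det.continuousAt (by simpa using h))
        hG.matrix_adjugate.continuousAt
    have h2 : ContinuousAt (fun ε : ℝ => rsv ε B) 0 := by
      unfold rsv
      have h3 : Continuous fun X : Matrix (Fin i) (Fin i) ℝ => 1 - Bᵀ * X * B := by fun_prop
      exact h3.continuousAt.comp h1
    exact (continuous_apply_apply (ρ := fun _ _ => ℝ) k k).continuousAt.comp h2
  have h0 : rsv 0 B k k = prj B k k := by simp [rsv, prj]
  rw [← h0]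
  exact hc.tendsto.comp tendsto_one_div_add_atTop_nhds_zero_nat

lemma det_ne_zero_of_li (B : Matrix (Fin i) (Fin n) ℝ) (h : LinearIndependent ℝ B.row) :
    (B * Bᵀ).det ≠ 0 := by
  have h1 : (B * Bᵀ).rank = i := by
    rw [rank_self_mul_transpose]
    simpa using h.rank_matrix
  intro h0
  obtain ⟨v, hv, hv0⟩ := Matrix.exists_mulVec_eq_zero_iff.2 h0
  have h2 := LinearMap.finrank_range_add_finrank_ker (B * Bᵀ).mulVecLin
  change (B * Bᵀ).rank + _ = _ at h2
  rw [h1, Module.finrank_fin_fun] at h2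
  have h3 := Submodule.finrank_eq_zero.1 (show Module.finrank ℝ (B * Bᵀ).mulVecLin.ker = 0 by omega)
  have h4 : v ∈ (B * Bᵀ).mulVecLin.ker := hv0
  rw [h3] at h4
  exact hv h4

end LinAlg

section Meas

variable {α : Type*} [MeasurableSpace α]

lemma measurable_det_entry {m : ℕ} {M : α → Matrix (Fin m) (Fin m) ℝ}
    (h : ∀ a b, Measurable fun ω => M ω a b) : Measurable fun ω => (M ω).det := by
  simp only [Matrix.det_apply]
  refine Finset.measurable_sum _ fun σ _ => ?_
  exact (Finset.measurable_prod _ fun k _ => h _ _).const_smul (Equiv.Perm.sign σ)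

lemma measurable_inv_entry {m : ℕ} {M : α → Matrix (Fin m) (Fin m) ℝ}
    (h : ∀ a b, Measurable fun ω => M ω a b) (a b : Fin m) :
    Measurable fun ω => (M ω)⁻¹ a b := by
  simp only [Matrix.inv_def, Ring.inverse_eq_inv', Matrix.smul_apply, smul_eq_mul,
    Matrix.adjugate_apply]
  refine (measurable_det_entry h).inv.mul (measurable_det_entry fun c e => ?_)
  simp only [Matrix.updateRow_apply]
  split_ifs
  · exact measurable_const
  · exact h _ _

lemma measurable_mul_entry {l m n : ℕ} {M : α → Matrix (Fin l) (Fin m) ℝ}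
    {N : α → Matrix (Fin m) (Fin n) ℝ}
    (hM : ∀ a b, Measurable fun ω => M ω a b) (hN : ∀ a b, Measurable fun ω => N ω a b) (a b) :
    Measurable fun ω => (M ω * N ω) a b := by
  simp only [Matrix.mul_apply]
  exact Finset.measurable_sum _ fun k _ => (hM _ _).mul (hN _ _)

lemma measurable_rsv {i n : ℕ} (ε : ℝ) {B : α → Matrix (Fin i) (Fin n) ℝ}
    (hB : ∀ a b, Measurable fun ω => B ω a b) (a b) :
    Measurable fun ω => rsv ε (B ω) a b := by
  have hBt : ∀ a b, Measurable fun ω => (B ω)ᵀ a b := fun a b => hB b a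
  simp only [rsv, Matrix.sub_apply]
  refine measurable_const.sub (measurable_mul_entry (measurable_mul_entry hBt
    (measurable_inv_entry ?_)) hB _ _)
  intro a b
  simp only [Matrix.add_apply]
  exact (measurable_mul_entry hB hBt _ _).add measurable_const

lemma measurable_prj {i n : ℕ} {B : α → Matrix (Fin i) (Fin n) ℝ}
    (hB : ∀ a b, Measurable fun ω => B ω a b) (a b) :
    Measurable fun ω => prj (B ω) a b := by
  have := measurable_rsv 0 hB a b
  simpa [rsv, prj] using this

end Meas

section Trace

variable {n p : ℕ}

lemma measurable_uVec (i : ℕ) (k : Fin n) :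
    Measurable fun ω : Fin p → Fin n → ℝ => uVec ω i k := by
  unfold uVec
  split_ifs
  · fun_prop
  · exact measurable_const

lemma measurable_rowMat (A : Matrix (Fin n) (Fin n) ℝ) (i : ℕ) (a : Fin i) (b : Fin n) :
    Measurable fun ω : Fin p → Fin n → ℝ => rowMat A ω i a b := by
  simp only [rowMat, Matrix.of_apply, mulVec, dotProduct]
  exact Finset.measurable_sum _ fun k _ => (measurable_uVec _ _).const_mul _

/-- `tr (A² P_i)` for `A = diag a`. -/
noncomputable def ftr (a : Fin n → ℝ) (i : ℕ) (ω : Fin p → Fin n → ℝ) : ℝ :=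
  ∑ k, a k ^ 2 * prj (rowMat (Matrix.diagonal a) ω i) k k

/-- Regularised version of `ftr`. -/
noncomputable def freg (ε : ℝ) (a : Fin n → ℝ) (i : ℕ) (ω : Fin p → Fin n → ℝ) : ℝ :=
  ∑ k, a k ^ 2 * rsv ε (rowMat (Matrix.diagonal a) ω i) k k

lemma measurable_ftr (a : Fin n → ℝ) (i : ℕ) : Measurable (ftr (p := p) a i) :=
  Finset.measurable_sum _ fun _ _ =>
    (measurable_prj (fun _ _ => measurable_rowMat _ _ _ _) _ _).const_mul _

lemma measurable_freg (ε : ℝ) (a : Fin n → ℝ) (i : ℕ) : Measurable (freg (p := p) ε a i) :=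
  Finset.measurable_sum _ fun _ _ =>
    (measurable_rsv ε (fun _ _ => measurable_rowMat _ _ _ _) _ _).const_mul _

lemma sum_bound (d r : Fin n → ℝ) {C : ℝ} (hd : ∀ k, 0 ≤ d k ∧ d k ≤ C)
    (hr : ∀ k, 0 ≤ r k ∧ r k ≤ 1) : 0 ≤ ∑ k, d k * r k ∧ ∑ k, d k * r k ≤ C * n := by
  constructor
  · exact Finset.sum_nonneg fun k _ => mul_nonneg (hd k).1 (hr k).1
  · calc ∑ k, d k * r k ≤ ∑ _k : Fin n, C := Finset.sum_le_sum fun k _ => by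
          nlinarith [hd k, hr k, mul_le_mul_of_nonneg_left (hr k).2 (hd k).1]
      _ = C * n := by simp [mul_comm]

lemma ftr_bound (a : Fin n → ℝ) {C : ℝ} (ha : ∀ k, a k ^ 2 ≤ C) (i : ℕ) (ω : Fin p → Fin n → ℝ) :
    0 ≤ ftr a i ω ∧ ftr a i ω ≤ C * n :=
  sum_bound _ _ (fun k => ⟨sq_nonneg _, ha k⟩) (fun k => prj_diag _ k)

lemma freg_bound {ε : ℝ} (hε : 0 < ε) (a : Fin n → ℝ) {C : ℝ} (ha : ∀ k, a k ^ 2 ≤ C) (i : ℕ)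
    (ω : Fin p → Fin n → ℝ) :
    0 ≤ freg ε a i ω ∧ freg ε a i ω ≤ C * n :=
  sum_bound _ _ (fun k => ⟨sq_nonneg _, ha k⟩) (fun k => rsv_diag _ hε k)

lemma Tstat_eq (a : Fin n → ℝ) (i : ℕ) :
    Tstat n p (Matrix.diagonal a) i = ∫ ω, ftr a i ω ∂(sphereLaw n p) := by
  unfold Tstat ftr
  rw [integral_finsetSum]
  · simp only [Matrix.trace, Matrix.diagonal_mul_diagonal, Matrix.diag_apply, Matrix.diagonal_mul]
    refine Finset.sum_congr rfl fun k _ => ?_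
    rw [integral_const_mul, meanProj, Matrix.of_apply, sq]
    rfl
  · intro k _
    refine Integrable.const_mul (integrable_of_bdd _
      (measurable_prj (fun _ _ => measurable_rowMat _ _ _ _) _ _) (K := 1) fun ω => ?_) _
    have := prj_diag (rowMat (Matrix.diagonal a) ω i) k
    rw [abs_le]; constructor <;> linarith [this.1, this.2]

lemma freg_update {ε : ℝ} (hε : 0 < ε) (a : Fin n → ℝ) {C : ℝ} (hC : 0 ≤ C)
    (ha : ∀ k, a k ^ 2 ≤ C) (i : ℕ) (ω : Fin p → Fin n → ℝ) (j : Fin p) (x : Fin n → ℝ) :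
    |freg ε a i ω - freg ε a i (Function.update ω j x)| ≤ C := by
  by_cases hj : (j : ℕ) < i
  · have h1 : rowMat (Matrix.diagonal a) (Function.update ω j x) i
        = (rowMat (Matrix.diagonal a) ω i).updateRow ⟨j, hj⟩ ((Matrix.diagonal a).mulVec x) := by
      ext k l
      rw [Matrix.updateRow_apply]
      simp only [rowMat, Matrix.of_apply]
      by_cases hk : k = ⟨j, hj⟩
      · subst hk
        simp [uVec]
      · rw [if_neg hk]
        have : uVec (Function.update ω j x) (k : ℕ) = uVec ω (k : ℕ) := by
          unfold uVec
          split_ifs with h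
          · rw [Function.update_of_ne]
            intro h'
            apply hk
            rw [Fin.ext_iff] at h' ⊢
            exact h'
          · rfl
        rw [this]
    unfold freg
    rw [h1]
    exact rsv_update _ _ _ hε hC _ fun k => ⟨sq_nonneg _, ha k⟩
  · have h1 : rowMat (Matrix.diagonal a) (Function.update ω j x) i
        = rowMat (Matrix.diagonal a) ω i := by
      ext k l
      simp only [rowMat, Matrix.of_apply]
      have : uVec (Function.update ω j x) (k : ℕ) = uVec ω (k : ℕ) := by
        unfold uVec
        split_ifs with h
        · rw [Function.update_of_ne]
          intro h'
          rw [Fin.ext_iff] at h'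
          have := k.2
          simp at h'
          omega
        · rfl
      rw [this]
    unfold freg
    rw [h1, sub_self, abs_zero]
    exact hC

lemma ae_det (hpn : p ≤ n) (a : Fin n → ℝ) (ha : ∀ k, 0 < a k) {i : ℕ} (hi : i ≤ p) :
    ∀ᵐ ω ∂(sphereLaw n p),
      (rowMat (Matrix.diagonal a) ω i * (rowMat (Matrix.diagonal a) ω i)ᵀ).det ≠ 0 := by
  filter_upwards [ae_linearIndependent p hpn] with ω hω
  apply det_ne_zero_of_li
  have h1 : LinearIndependent ℝ fun k : Fin i => ω (Fin.castLE hi k) :=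
    hω.comp _ (Fin.castLE_injective hi)
  have hdet : IsUnit (Matrix.diagonal a).det := by
    rw [Matrix.det_diagonal]
    exact (Finset.prod_pos fun k _ => ha k).ne'.isUnit
  have h2 := h1.map' (Matrix.diagonal a).mulVecLin (LinearMap.ker_eq_bot.2
    (Matrix.mulVec_injective_iff_isUnit.2 ((Matrix.isUnit_iff_isUnit_det _).2 hdet)))
  have heq : (rowMat (Matrix.diagonal a) ω i).row
      = (Matrix.diagonal a).mulVecLin ∘ fun k => ω (Fin.castLE hi k) := by
    ext k l
    simp only [Matrix.row, rowMat, Matrix.of_apply, Function.comp, Matrix.mulVecLin_apply]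
    have : uVec ω (k : ℕ) = ω (Fin.castLE hi k) := by
      unfold uVec
      rw [dif_pos (lt_of_lt_of_le k.2 hi)]
      rfl
    rw [this]
  rw [heq]
  exact h2

lemma ftr_mgf (hpn : p ≤ n) (a : Fin n → ℝ) (ha0 : ∀ k, 0 < a k) {C : ℝ} (hC : 0 ≤ C)
    (ha : ∀ k, a k ^ 2 ≤ C) {i : ℕ} (hi : i ≤ p) (t : ℝ) :
    ∫ ω, Real.exp (t * (ftr a i ω - Tstat n p (Matrix.diagonal a) i)) ∂(sphereLaw n p)
      ≤ Real.exp (p * (C ^ 2 * t ^ 2 / 2)) := by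
  set e : ℕ → ℝ := fun m => 1 / ((m : ℝ) + 1) with he
  have he0 : ∀ m, 0 < e m := fun m => by rw [he]; positivity
  have hlim : ∀ᵐ ω ∂(sphereLaw n p), Tendsto (fun m => freg (e m) a i ω) atTop (𝓝 (ftr a i ω)) := by
    filter_upwards [ae_det hpn a ha0 hi] with ω hω
    exact tendsto_finsetSum _ fun k _ => (rsv_tendsto _ hω k).const_mul _
  have hbd : ∀ m (ω : Fin p → Fin n → ℝ), |freg (e m) a i ω| ≤ C * n := by
    intro m ω
    have := freg_bound (he0 m) a ha i ω
    rw [abs_of_nonneg this.1]; exact this.2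
  have hT : Tendsto (fun m => ∫ ω, freg (e m) a i ω ∂(sphereLaw n p)) atTop
      (𝓝 (Tstat n p (Matrix.diagonal a) i)) := by
    rw [Tstat_eq]
    exact tendsto_integral_of_dominated_convergence (fun _ => C * n)
      (fun m => (measurable_freg _ _ _).aestronglyMeasurable) (integrable_const _)
      (fun m => Filter.Eventually.of_forall fun ω => hbd m ω) hlim
  have hTb : ∀ m, |∫ ω, freg (e m) a i ω ∂(sphereLaw n p)| ≤ C * n := by
    intro m
    have := norm_integral_le_of_norm_le_const (μ := sphereLaw n p)
        (f := freg (e m) a i) (C := C * n) (Filter.Eventually.of_forall fun ω => hbd m ω)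
    simpa using this
  have hE : Tendsto (fun m => ∫ ω, Real.exp (t * (freg (e m) a i ω
      - ∫ ω', freg (e m) a i ω' ∂(sphereLaw n p))) ∂(sphereLaw n p)) atTop
      (𝓝 (∫ ω, Real.exp (t * (ftr a i ω - Tstat n p (Matrix.diagonal a) i)) ∂(sphereLaw n p))) := by
    refine tendsto_integral_of_dominated_convergence (fun _ => Real.exp (|t| * (C * n + C * n)))
      (fun m => ?_) (integrable_const _) (fun m => Filter.Eventually.of_forall fun ω => ?_) ?_
    · have := measurable_freg (p := p) (e m) a i
      exact Measurable.aestronglyMeasurable (by fun_prop)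
    · rw [Real.norm_eq_abs, Real.abs_exp]
      apply Real.exp_le_exp.2
      refine (le_abs_self _).trans ?_
      rw [abs_mul]
      gcongr
      exact (abs_sub _ _).trans (add_le_add (hbd _ _) (hTb _))
    · filter_upwards [hlim] with ω hω
      exact (Real.continuous_exp.tendsto _).comp ((hω.sub hT).const_mul t)
  refine le_of_tendsto' hE fun m => ?_
  exact mcdiarmid_mgf (uniformSphere n) C (C * n) t p (freg (e m) a i)
    (measurable_freg _ _ _) (hbd m) (freg_update (he0 m) a hC ha i)

lemma ftr_tail (hpn : p ≤ n) (a : Fin n → ℝ) (ha0 : ∀ k, 0 < a k) {C : ℝ} (hC : 0 < C)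
    (ha : ∀ k, a k ^ 2 ≤ C) {i : ℕ} (hi : i ≤ p) {η : ℝ} (hη : 0 < η) :
    sphereLaw n p {ω | η * n < |ftr a i ω - Tstat n p (Matrix.diagonal a) i|}
      ≤ ENNReal.ofReal (2 * Real.exp (-(η ^ 2 / (2 * C ^ 2)) * n)) := by
  set T := Tstat n p (Matrix.diagonal a) i with hT
  have hside : ∀ t : ℝ, |t| = η / C ^ 2 →
      sphereLaw n p {ω | |t| * (η * n) ≤ t * (ftr a i ω - T)}
        ≤ ENNReal.ofReal (Real.exp (-(η ^ 2 / (2 * C ^ 2)) * n)) := by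
    intro t ht
    have hm := measurable_ftr (p := p) a i
    have hIntg : Integrable (fun ω => Real.exp (t * (ftr a i ω - T))) (sphereLaw n p) := by
      refine integrable_of_bdd _ (by fun_prop) (K := Real.exp (|t| * (C * n + |T|))) fun ω => ?_
      rw [Real.abs_exp]
      apply Real.exp_le_exp.2
      refine (le_abs_self _).trans ?_
      rw [abs_mul]
      gcongr
      refine (abs_sub _ _).trans ?_
      have := ftr_bound a ha i ω
      rw [abs_of_nonneg this.1]
      gcongr
      exact this.2
    have hmk := mul_meas_ge_le_integral_of_nonneg (μ := sphereLaw n p)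
      (Filter.Eventually.of_forall fun ω => (Real.exp_pos _).le) hIntg (Real.exp (|t| * (η * n)))
    have h2 := hmk.trans (ftr_mgf hpn a ha0 hC.le ha hi t)
    simp only [Real.exp_le_exp] at h2
    rw [← ofReal_measureReal]
    apply ENNReal.ofReal_le_ofReal
    rw [← le_div_iff₀' (Real.exp_pos _), ← Real.exp_sub] at h2
    refine h2.trans (Real.exp_le_exp.2 ?_)
    rw [← sq_abs t, ht]
    have hpn' : (p : ℝ) ≤ n := by exact_mod_cast hpn
    have h3 : C ^ 2 * (η / C ^ 2) ^ 2 / 2 = η ^ 2 / (2 * C ^ 2) := by field_simp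
    have h4 : η / C ^ 2 * (η * n) = 2 * (η ^ 2 / (2 * C ^ 2)) * n := by field_simp
    rw [h3, h4]
    have h5 : 0 ≤ η ^ 2 / (2 * C ^ 2) := by positivity
    nlinarith [mul_le_mul_of_nonneg_right hpn' h5]
  have hq : 0 < η / C ^ 2 := by positivity
  have hsub : {ω : Fin p → Fin n → ℝ | η * n < |ftr a i ω - T|} ⊆
      {ω | |η / C ^ 2| * (η * n) ≤ (η / C ^ 2) * (ftr a i ω - T)} ∪
      {ω | |-(η / C ^ 2)| * (η * n) ≤ -(η / C ^ 2) * (ftr a i ω - T)} := by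
    intro ω hω
    simp only [Set.mem_union, Set.mem_ofPred_eq, abs_neg, abs_of_pos hq] at hω ⊢
    rcases lt_abs.1 hω with h | h
    · left; exact mul_le_mul_of_nonneg_left h.le hq.le
    · right
      rw [neg_mul, ← mul_neg]
      exact mul_le_mul_of_nonneg_left h.le hq.le
  refine (measure_mono hsub).trans ((measure_union_le _ _).trans ?_)
  rw [two_mul, ENNReal.ofReal_add (Real.exp_pos _).le (Real.exp_pos _).le]
  exact add_le_add (hside _ (abs_of_pos hq)) (hside _ (by rw [abs_neg, abs_of_pos hq]))

end Trace

section Final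

variable {n p : ℕ}

lemma sphere_quad_tail (hn : 0 < n) (M : Matrix (Fin n) (Fin n) ℝ) (hM : M.IsHermitian) {C η s : ℝ}
    (hq : ∀ x : Fin n → ℝ, 0 ≤ x ⬝ᵥ M *ᵥ x ∧ x ⬝ᵥ M *ᵥ x ≤ C * (x ⬝ᵥ x))
    (htr : 0 ≤ M.trace ∧ M.trace ≤ C * n) (hη : 0 < η)
    (hs : 0 < s) (hsK : s * (C + η) ≤ 1 / 4) (hsη : 8 * s * (C + η) ^ 2 ≤ η) :
    uniformSphere n {x | η * n < |n * (x ⬝ᵥ M *ᵥ x) - M.trace|}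
      ≤ ENNReal.ofReal (2 * Real.exp (-(s * η / 2) * n)) := by
  have hn' : (0 : ℝ) < n := by exact_mod_cast hn
  set τ := M.trace / n with hτ
  have hτn : τ * n = M.trace := by rw [hτ]; field_simp
  have hτ0 : 0 ≤ τ := div_nonneg htr.1 hn'.le
  have hτC : τ ≤ C := by rw [hτ, div_le_iff₀ hn']; exact htr.2
  have hSm : MeasurableSet {x : Fin n → ℝ | η * n < |n * (x ⬝ᵥ M *ᵥ x) - M.trace|} := by
    apply measurableSet_lt measurable_const
    exact Continuous.measurable (by fun_prop)
  -- the two shifted matrices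
  have hcase : ∀ σ : ℝ, |σ| = 1 →
      gaussianPi n {x | 0 < x ⬝ᵥ (σ • (M - τ • (1 : Matrix (Fin n) (Fin n) ℝ)) - η • (1 : Matrix (Fin n) (Fin n) ℝ)) *ᵥ x}
        ≤ ENNReal.ofReal (Real.exp (-(s * η / 2) * n)) := by
    intro σ hσ
    refine quad_tail _ ?_ (K := C + η) (η := η) ?_ ?_ hs hsK hsη
    · have hMt : Mᵀ = M := by simpa using hM.eq
      rw [Matrix.IsHermitian, conjTranspose_eq_transpose_of_trivial]
      simp [transpose_sub, transpose_smul, hMt]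
    · intro x
      have hx := dot_self_nonneg x
      have h1 : x ⬝ᵥ (σ • (M - τ • (1 : Matrix (Fin n) (Fin n) ℝ))
          - η • (1 : Matrix (Fin n) (Fin n) ℝ)) *ᵥ x
          = σ * (x ⬝ᵥ M *ᵥ x - τ * (x ⬝ᵥ x)) - η * (x ⬝ᵥ x) := by
        simp [sub_mulVec, smul_mulVec, dotProduct_sub, dotProduct_smul]
      rw [h1]
      refine (abs_sub _ _).trans ?_
      rw [abs_mul, hσ, one_mul, abs_of_nonneg (mul_nonneg hη.le hx), add_mul]
      gcongr
      rw [abs_le]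
      have := hq x
      constructor
      · nlinarith [mul_le_mul_of_nonneg_right hτC hx]
      · nlinarith [mul_nonneg hτ0 hx]
    · simp only [trace_sub, trace_smul, trace_one, Fintype.card_fin, smul_eq_mul]
      rw [hτn, sub_self]; simp
  have hzero : gaussianPi n ({0} : Set (Fin n → ℝ)) = 0 := by
    have := gaussianPi_submodule (n := n) ⊥ (by
      haveI : Nonempty (Fin n) := ⟨⟨0, hn⟩⟩
      exact bot_ne_top)
    simpa using this
  unfold uniformSphere
  rw [Measure.map_apply measurable_normalize hSm]
  have hsub : (fun x : Fin n → ℝ => (euclidNorm x)⁻¹ • x) ⁻¹'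
      {x | η * n < |n * (x ⬝ᵥ M *ᵥ x) - M.trace|} ⊆
      ({x | 0 < x ⬝ᵥ ((1 : ℝ) • (M - τ • (1 : Matrix (Fin n) (Fin n) ℝ)) - η • (1 : Matrix (Fin n) (Fin n) ℝ)) *ᵥ x} ∪
      {x | 0 < x ⬝ᵥ ((-1 : ℝ) • (M - τ • (1 : Matrix (Fin n) (Fin n) ℝ)) - η • (1 : Matrix (Fin n) (Fin n) ℝ)) *ᵥ x}) ∪ {0} := by
    intro x hx
    by_cases hx0 : x = 0
    · right; exact hx0
    left
    have hr := euclidNorm_pos hx0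
    have hrr : euclidNorm x ^ 2 = x ⬝ᵥ x := by
      unfold euclidNorm
      rw [Real.sq_sqrt (Finset.sum_nonneg fun i _ => sq_nonneg _)]
      simp [dotProduct, sq]
    set r := euclidNorm x
    have hform : ∀ σ : ℝ, x ⬝ᵥ (σ • (M - τ • (1 : Matrix (Fin n) (Fin n) ℝ))
          - η • (1 : Matrix (Fin n) (Fin n) ℝ)) *ᵥ x
          = σ * (x ⬝ᵥ M *ᵥ x - τ * (x ⬝ᵥ x)) - η * (x ⬝ᵥ x) := by
      intro σ
      simp [sub_mulVec, smul_mulVec, dotProduct_sub, dotProduct_smul]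
    simp only [Set.mem_preimage, Set.mem_ofPred_eq, mulVec_smul, dotProduct_smul, smul_dotProduct,
      smul_eq_mul] at hx
    simp only [Set.mem_union, Set.mem_ofPred_eq, hform, ← hrr]
    set q := x ⬝ᵥ M *ᵥ x
    have hx2 : η * r ^ 2 < |q - τ * r ^ 2| := by
      have h1 : n * (r⁻¹ * (r⁻¹ * q)) - M.trace = (n / r ^ 2) * (q - τ * r ^ 2) := by
        rw [← hτn]; field_simp
      rw [h1, abs_mul, abs_of_pos (by positivity : (0 : ℝ) < n / r ^ 2)] at hx
      have h2 : η * n = (n / r ^ 2) * (η * r ^ 2) := by field_simp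
      rw [h2] at hx
      exact lt_of_mul_lt_mul_left hx (by positivity)
    rcases lt_abs.1 hx2 with h | h
    · left; linarith
    · right; linarith
  refine (measure_mono hsub).trans ((measure_union_le _ _).trans ?_)
  rw [hzero, add_zero]
  refine (measure_union_le _ _).trans ?_
  rw [two_mul, ENNReal.ofReal_add (Real.exp_pos _).le (Real.exp_pos _).le]
  exact add_le_add (hcase 1 (by simp)) (hcase (-1) (by simp))

/-- `A P_i A` for `A = diag a`. -/
noncomputable def apa (a : Fin n → ℝ) (i : ℕ) (ω : Fin p → Fin n → ℝ) : Matrix (Fin n) (Fin n) ℝ :=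
  Matrix.diagonal a * prj (rowMat (Matrix.diagonal a) ω i) * Matrix.diagonal a

lemma apa_trace (a : Fin n → ℝ) (i : ℕ) (ω : Fin p → Fin n → ℝ) :
    (apa a i ω).trace = ftr a i ω := by
  unfold apa ftr Matrix.trace
  refine Finset.sum_congr rfl fun k _ => ?_
  simp only [Matrix.diag_apply, Matrix.mul_diagonal, Matrix.diagonal_mul]
  ring

lemma apa_quad (a : Fin n → ℝ) {C : ℝ} (ha : ∀ k, a k ^ 2 ≤ C) (i : ℕ) (ω : Fin p → Fin n → ℝ)
    (x : Fin n → ℝ) : 0 ≤ x ⬝ᵥ apa a i ω *ᵥ x ∧ x ⬝ᵥ apa a i ω *ᵥ x ≤ C * (x ⬝ᵥ x) := by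
  set P := prj (rowMat (Matrix.diagonal a) ω i) with hP
  have h1 : x ⬝ᵥ apa a i ω *ᵥ x = (Matrix.diagonal a *ᵥ x) ⬝ᵥ P *ᵥ (Matrix.diagonal a *ᵥ x) := by
    unfold apa
    rw [← mulVec_mulVec, ← mulVec_mulVec, dotProduct_mulVec, ← mulVec_transpose,
      diagonal_transpose]
  rw [h1]
  refine ⟨prj_quad_nonneg _ _, (prj_quad_le _ _).trans ?_⟩
  simp only [dotProduct, mulVec_diagonal, Finset.mul_sum]
  refine Finset.sum_le_sum fun k _ => ?_
  nlinarith [mul_le_mul_of_nonneg_right (ha k) (mul_self_nonneg (x k))]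

lemma measurable_apa (a : Fin n → ℝ) (i : ℕ) (k l : Fin n) :
    Measurable fun ω : Fin p → Fin n → ℝ => apa a i ω k l := by
  unfold apa
  simp only [Matrix.mul_diagonal, Matrix.diagonal_mul]
  exact ((measurable_prj (fun _ _ => measurable_rowMat _ _ _ _) _ _).const_mul _).mul_const _

lemma quad_part (hn : 0 < n) (a : Fin n → ℝ) {C : ℝ} (ha : ∀ k, a k ^ 2 ≤ C)
    {i : ℕ} (hi : i < p) {η s : ℝ} (hη : 0 < η)
    (hs : 0 < s) (hsK : s * (C + η) ≤ 1 / 4) (hsη : 8 * s * (C + η) ^ 2 ≤ η) :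
    sphereLaw n p {ω | η * n < |n * (uVec ω i ⬝ᵥ apa a i ω *ᵥ uVec ω i) - ftr a i ω|}
      ≤ ENNReal.ofReal (2 * Real.exp (-(s * η / 2) * n)) := by
  unfold sphereLaw
  refine pi_slice_le (uniformSphere n) ⟨i, hi⟩ ?_ _ fun ω => ?_
  · apply measurableSet_lt measurable_const
    have h1 := measurable_ftr (p := p) a i
    have h2 : Measurable fun ω : Fin p → Fin n → ℝ => uVec ω i ⬝ᵥ apa a i ω *ᵥ uVec ω i := by
      simp only [dotProduct, mulVec]
      refine Finset.measurable_sum _ fun k _ => (measurable_uVec _ _).mul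
        (Finset.measurable_sum _ fun l _ => (measurable_apa _ _ _ _).mul (measurable_uVec _ _))
    exact ((h2.const_mul _).sub h1).abs
  · have hrow : ∀ x, rowMat (Matrix.diagonal a) (Function.update ω ⟨i, hi⟩ x) i
        = rowMat (Matrix.diagonal a) ω i := by
      intro x
      ext k l
      simp only [rowMat, Matrix.of_apply]
      have : uVec (Function.update ω ⟨i, hi⟩ x) (k : ℕ) = uVec ω (k : ℕ) := by
        unfold uVec
        split_ifs with h
        · rw [Function.update_of_ne]
          intro h'
          rw [Fin.ext_iff] at h'
          have := k.2
          simp at h'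
          omega
        · rfl
      rw [this]
    have hapa : ∀ x, apa a i (Function.update ω ⟨i, hi⟩ x) = apa a i ω := by
      intro x; unfold apa; rw [hrow]
    have hftr : ∀ x, ftr a i (Function.update ω ⟨i, hi⟩ x) = ftr a i ω := by
      intro x; unfold ftr; rw [hrow]
    have hu : ∀ x, uVec (Function.update ω ⟨i, hi⟩ x) i = x := by
      intro x; simp [uVec, hi]
    simp only [Set.mem_ofPred_eq, hapa, hftr, hu]
    rw [← apa_trace]
    refine sphere_quad_tail hn _ ?_ (apa_quad a ha i ω) ?_ hη hs hsK hsη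
    · rw [Matrix.IsHermitian, conjTranspose_eq_transpose_of_trivial, apa, transpose_mul,
        transpose_mul, diagonal_transpose, prj_transpose, Matrix.mul_assoc]
    · rw [apa_trace]
      exact ftr_bound a ha i ω

lemma Tstat_lower (a : Fin n → ℝ) {C : ℝ} (hC : 0 < C)
    (ha : ∀ k, C⁻¹ ≤ a k ^ 2 ∧ a k ^ 2 ≤ C) (i : ℕ) :
    C⁻¹ * ((n : ℝ) - i) ≤ Tstat n p (Matrix.diagonal a) i := by
  rw [Tstat_eq]
  have h1 : ∀ ω : Fin p → Fin n → ℝ, C⁻¹ * ((n : ℝ) - i) ≤ ftr a i ω := by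
    intro ω
    refine (mul_le_mul_of_nonneg_left (prj_trace (rowMat (Matrix.diagonal a) ω i))
      (inv_pos.2 hC).le).trans ?_
    unfold ftr Matrix.trace
    rw [Finset.mul_sum]
    exact Finset.sum_le_sum fun k _ => mul_le_mul_of_nonneg_right (ha k).1 (prj_diag _ k).1
  have hIntg : Integrable (fun ω : Fin p → Fin n → ℝ => ftr a i ω) (sphereLaw n p) :=
    integrable_of_bdd _ (measurable_ftr a i) (K := C * n) fun ω => by
      have := ftr_bound a (fun k => (ha k).2) i ω
      rw [abs_of_nonneg this.1]; exact this.2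
  have := integral_mono (μ := sphereLaw n p) (integrable_const (C⁻¹ * ((n : ℝ) - i))) hIntg h1
  simpa using this

lemma main_bound (hn : 0 < n) (hpn : p ≤ n) (a : Fin n → ℝ) (ha0 : ∀ k, 0 < a k) {C : ℝ}
    (hC : 0 < C) (ha : ∀ k, C⁻¹ ≤ a k ^ 2 ∧ a k ^ 2 ≤ C) {δ ε η s : ℝ} (hδ : 0 < δ) (hε : 0 < ε)
    (hpδ : (p : ℝ) ≤ (1 - δ) * n) (hη : η = ε * (C⁻¹ * δ) / 2)
    (hs : 0 < s) (hsK : s * (C + η) ≤ 1 / 4) (hsη : 8 * s * (C + η) ^ 2 ≤ η) :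
    sphereLaw n p {ω | ∃ i < p, ε < |Ztil (Matrix.diagonal a) ω i|}
      ≤ ENNReal.ofReal (n * (2 * Real.exp (-(s * η / 2) * n)
          + 2 * Real.exp (-(η ^ 2 / (2 * C ^ 2)) * n))) := by
  have hn' : (0 : ℝ) < n := by exact_mod_cast hn
  have hη0 : 0 < η := by rw [hη]; positivity
  have ha2 : ∀ k, a k ^ 2 ≤ C := fun k => (ha k).2
  set S1 : ℕ → Set (Fin p → Fin n → ℝ) := fun i =>
    {ω | η * n < |n * (uVec ω i ⬝ᵥ apa a i ω *ᵥ uVec ω i) - ftr a i ω|} with hS1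
  set S2 : ℕ → Set (Fin p → Fin n → ℝ) := fun i =>
    {ω | η * n < |ftr a i ω - Tstat n p (Matrix.diagonal a) i|} with hS2
  have hsub : {ω : Fin p → Fin n → ℝ | ∃ i < p, ε < |Ztil (Matrix.diagonal a) ω i|}
      ⊆ ⋃ i ∈ Finset.range p, (S1 i ∪ S2 i) := by
    rintro ω ⟨i, hi, hω⟩
    simp only [Set.mem_iUnion, Finset.mem_range]
    refine ⟨i, hi, ?_⟩
    by_contra hcon
    simp only [Set.mem_union, not_or, hS1, hS2, Set.mem_ofPred_eq, not_lt] at hcon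
    have hi' : (i : ℝ) ≤ p := by exact_mod_cast hi.le
    have hT1 := Tstat_lower (p := p) a hC ha i
    set T := Tstat n p (Matrix.diagonal a) i with hT
    have hT2 : C⁻¹ * δ * n ≤ T := by
      refine le_trans ?_ hT1
      rw [mul_assoc]
      apply mul_le_mul_of_nonneg_left _ (inv_pos.2 hC).le
      linarith
    have hT0 : 0 < T := lt_of_lt_of_le (by positivity) hT2
    have hZ : Ztil (Matrix.diagonal a) ω i
        = T⁻¹ * (n * (uVec ω i ⬝ᵥ apa a i ω *ᵥ uVec ω i) - T) := by
      have : Ztil (Matrix.diagonal a) ω i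
          = n * (uVec ω i ⬝ᵥ (T⁻¹ • apa a i ω) *ᵥ uVec ω i) - 1 := rfl
      rw [this, smul_mulVec, dotProduct_smul, smul_eq_mul]
      field_simp
    rw [hZ, abs_mul, abs_of_pos (inv_pos.2 hT0), ← div_eq_inv_mul, lt_div_iff₀ hT0] at hω
    have h3 := abs_sub_le (n * (uVec ω i ⬝ᵥ apa a i ω *ᵥ uVec ω i)) (ftr a i ω) T
    have h4 : η * n + η * n = ε * (C⁻¹ * δ * n) := by rw [hη]; ring
    have h5 := mul_le_mul_of_nonneg_left hT2 hε.le
    linarith [hcon.1, hcon.2]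
  refine (measure_mono hsub).trans ((measure_biUnion_finset_le _ _).trans ?_)
  set b := 2 * Real.exp (-(s * η / 2) * n) + 2 * Real.exp (-(η ^ 2 / (2 * C ^ 2)) * n) with hb
  have hb0 : 0 ≤ b := by positivity
  calc ∑ i ∈ Finset.range p, sphereLaw n p (S1 i ∪ S2 i)
      ≤ ∑ _i ∈ Finset.range p, ENNReal.ofReal b := by
        refine Finset.sum_le_sum fun i hi => ?_
        rw [Finset.mem_range] at hi
        refine (measure_union_le _ _).trans ?_
        rw [hb, ENNReal.ofReal_add (by positivity) (by positivity)]
        exact add_le_add (quad_part hn a ha2 hi hη0 hs hsK hsη)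
          (ftr_tail hpn a ha0 hC ha2 hi.le hη0)
    _ = ENNReal.ofReal (p * b) := by
        rw [Finset.sum_const, Finset.card_range, nsmul_eq_mul, ENNReal.ofReal_mul (by positivity)]
        simp
    _ ≤ _ := by
        apply ENNReal.ofReal_le_ofReal
        have : (p : ℝ) ≤ n := by exact_mod_cast hpn
        gcongr

lemma tendsto_mul_exp_neg {c : ℝ} (hc : 0 < c) :
    Tendsto (fun n : ℕ => (n : ℝ) * Real.exp (-c * n)) atTop (𝓝 0) := by
  have h := (Real.tendsto_pow_mul_exp_neg_atTop_nhds_zero 1).comp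
    (tendsto_natCast_atTop_atTop.const_mul_atTop hc)
  have h2 := h.const_mul c⁻¹
  rw [mul_zero] at h2
  refine h2.congr fun n => ?_
  simp only [Function.comp, pow_one]
  rw [neg_mul]
  field_simp

end Final

/-- Under Assumption (A) (`p/n → γ ∈ (0,1)`) and the bound
`C⁻¹ ≤ A_{kk}² ≤ C`, the maximum `max_{i=0,…,p−1} |Z̃_{i+1}|` converges to `0`
in probability as `n → ∞`. -/
theorem max_Ztil_tendsto_zero (p : ℕ → ℕ) (γ : ℝ) (A : ∀ n, Matrix (Fin n) (Fin n) ℝ)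
    (hp : ∀ n, p n ≤ n)
    (hdiag : ∀ n, (A n).IsDiag) (hpos : ∀ n k, 0 < A n k k)
    (htr : ∀ n, Matrix.trace (A n * A n) = (n : ℝ))
    (hγ : 0 < γ ∧ γ < 1)
    (hA : Tendsto (fun n => (p n : ℝ) / (n : ℝ)) atTop (𝓝 γ))
    (C : ℝ) (hC : 1 ≤ C)
    (hCb : ∀ n k, C⁻¹ ≤ (A n k k) ^ 2 ∧ (A n k k) ^ 2 ≤ C) :
    ∀ ε : ℝ, 0 < ε →
      Tendsto (fun n => sphereLaw n (p n) {ω | ∃ i < p n, ε < |Ztil (A n) ω i|})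
        atTop (𝓝 0) := by
  intro ε hε
  have hC0 : 0 < C := by linarith
  set δ : ℝ := (1 - γ) / 2 with hδ
  have hδ0 : 0 < δ := by rw [hδ]; linarith [hγ.2]
  set η : ℝ := ε * (C⁻¹ * δ) / 2 with hη
  have hη0 : 0 < η := by rw [hη]; positivity
  set s : ℝ := min (1 / (4 * (C + η))) (η / (8 * (C + η) ^ 2)) with hs
  have hs0 : 0 < s := lt_min (by positivity) (by positivity)
  have hsK : s * (C + η) ≤ 1 / 4 := by
    calc s * (C + η) ≤ 1 / (4 * (C + η)) * (C + η) :=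
          mul_le_mul_of_nonneg_right (min_le_left _ _) (by positivity)
      _ = 1 / 4 := by field_simp
  have hsη : 8 * s * (C + η) ^ 2 ≤ η := by
    calc 8 * s * (C + η) ^ 2 = s * (8 * (C + η) ^ 2) := by ring
      _ ≤ η / (8 * (C + η) ^ 2) * (8 * (C + η) ^ 2) :=
          mul_le_mul_of_nonneg_right (min_le_right _ _) (by positivity)
      _ = η := by field_simp
  have hev : ∀ᶠ n : ℕ in atTop, (p n : ℝ) / n < 1 - δ :=
    hA.eventually (gt_mem_nhds (by rw [hδ]; linarith [hγ.2]))
  have hlim : Tendsto (fun n : ℕ => ENNReal.ofReal ((n : ℝ) * (2 * Real.exp (-(s * η / 2) * n)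
          + 2 * Real.exp (-(η ^ 2 / (2 * C ^ 2)) * n)))) atTop (𝓝 0) := by
    rw [← ENNReal.ofReal_zero]
    apply ENNReal.tendsto_ofReal
    have h1 := (tendsto_mul_exp_neg (c := s * η / 2) (by positivity)).const_mul 2
    have h2 := (tendsto_mul_exp_neg (c := η ^ 2 / (2 * C ^ 2)) (by positivity)).const_mul 2
    have h3 := h1.add h2
    simp only [mul_zero, add_zero] at h3
    refine h3.congr fun n => ?_
    ring
  refine tendsto_of_tendsto_of_tendsto_of_le_of_le' tendsto_const_nhds hlim
    (Filter.Eventually.of_forall fun n => zero_le) ?_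
  filter_upwards [hev, eventually_gt_atTop 0] with n hn hn0
  have hn' : (0 : ℝ) < n := by exact_mod_cast hn0
  have hAd : A n = Matrix.diagonal (fun k => A n k k) := by
    ext k l
    by_cases hkl : k = l
    · subst hkl; simp
    · rw [Matrix.diagonal_apply_ne _ hkl]; exact hdiag n hkl
  rw [hAd]
  exact main_bound hn0 (hp n) (fun k => A n k k) (hpos n) hC0 (hCb n) hδ0 hε
    ((div_lt_iff₀ hn').1 hn).le hη hs0 hsK hsη
end

section
/- Let A be a diagonal n×n matrix with positive diagonal entries A_{kk}, let 1 ≤ i ≤ p−1 ≤ n−1, and let p_{i,kk} denote the k-th diagonal entry of the projection matrix P_i. Then E[p_{i,kk}] = E[1/(1 + A_{kk}² w_{ik}ᵀ (∑_{ℓ=1, ℓ≠k}^n A_{ℓℓ}² w_{iℓ} w_{iℓ}ᵀ)^{−1} w_{ik})], where w_{i1},…,w_{in} are i.i.d. ℝ^i-valued random vectors whose components are independent standard normal random variables. -/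
open MeasureTheory ProbabilityTheory Matrix Filter Topology

lemma measurable_det_aux {α : Type*} [MeasurableSpace α] {m : ℕ}
    (M : α → Matrix (Fin m) (Fin m) ℝ) (hM : ∀ j l, Measurable fun a => M a j l) :
    Measurable fun a => (M a).det := by
  simp only [Matrix.det_apply]
  refine Finset.measurable_sum _ fun σ _ => ?_
  exact (Finset.measurable_prod _ fun j _ => hM _ _).const_smul _

lemma measurable_inv_aux {α : Type*} [MeasurableSpace α] {m : ℕ}
    (M : α → Matrix (Fin m) (Fin m) ℝ) (hM : ∀ j l, Measurable fun a => M a j l) (j l : Fin m) :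
    Measurable fun a => (M a)⁻¹ j l := by
  simp only [Matrix.inv_def, Ring.inverse_eq_inv', Matrix.smul_apply, smul_eq_mul,
    Matrix.adjugate_apply]
  refine (measurable_det_aux M hM).inv.mul (measurable_det_aux _ ?_)
  intro a b
  simp only [Matrix.updateRow_apply]
  split_ifs
  · exact measurable_const
  · exact hM _ _

lemma measurable_proj_aux {α : Type*} [MeasurableSpace α] {m n : ℕ}
    (B : α → Matrix (Fin m) (Fin n) ℝ) (hB : ∀ j l, Measurable fun a => B a j l) (k l : Fin n) :
    Measurable fun a => (1 - (B a)ᵀ * (B a * (B a)ᵀ)⁻¹ * B a : Matrix (Fin n) (Fin n) ℝ) k l := by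
  have h1 : ∀ j l, Measurable fun a => (B a * (B a)ᵀ)⁻¹ j l := by
    apply measurable_inv_aux
    intro j l
    simp only [Matrix.mul_apply, Matrix.transpose_apply]
    exact Finset.measurable_sum _ fun x _ => (hB _ _).mul (hB _ _)
  simp only [Matrix.sub_apply]
  refine measurable_const.sub ?_
  simp only [Matrix.mul_apply (M := (B _)ᵀ * (B _ * (B _)ᵀ)⁻¹),
    Matrix.mul_apply (M := (B _)ᵀ), Matrix.transpose_apply]
  exact Finset.measurable_sum _ fun x _ =>
    (Finset.measurable_sum _ fun y _ => (hB _ _).mul (h1 _ _)).mul (hB _ _)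

instance gaussianPi_prob (d : ℕ) : IsProbabilityMeasure (gaussianPi d) := by
  unfold gaussianPi; infer_instance

lemma gaussianPi_ac (d : ℕ) : gaussianPi d ≪ volume := by
  induction d with
  | zero =>
    unfold gaussianPi
    rw [volume_pi, Measure.pi_of_empty, Measure.pi_of_empty]
  | succ d ih =>
    have h1 := (measurePreserving_piFinSuccAbove
      (fun _ : Fin (d + 1) => gaussianReal 0 1) 0)
    have h2 := (volume_preserving_piFinSuccAbove (fun _ : Fin (d + 1) => ℝ) 0)
    have h3 : (gaussianReal 0 1).prod (gaussianPi d) ≪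
        (volume : Measure ℝ).prod (volume : Measure (Fin d → ℝ)) :=
      (gaussianReal_absolutelyContinuous 0 one_ne_zero).prod ih
    have h4 := h3.map h1.symm.measurable
    have h5 := h1.symm.map_eq
    have h6 := h2.symm.map_eq
    unfold gaussianPi at h4 ⊢
    rw [← h5, ← h6]
    exact h4

lemma ae_linearIndependent_s13 (d m : ℕ) (hm : m ≤ d) :
    ∀ᵐ v ∂(Measure.pi fun _ : Fin m => gaussianPi d), LinearIndependent ℝ v := by
  induction m with
  | zero => exact Filter.Eventually.of_forall fun v => linearIndependent_empty_type
  | succ m ih =>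
    have h1 := (measurePreserving_piFinSuccAbove
      (fun _ : Fin (m + 1) => gaussianPi d) 0)
    have hopen : MeasurableSet {v : Fin (m + 1) → Fin d → ℝ | LinearIndependent ℝ v} :=
      (isOpen_setOfPred_linearIndependent).measurableSet
    rw [← h1.symm.map_eq, ae_map_iff h1.symm.measurable.aemeasurable hopen]
    have hopen2 : MeasurableSet {x : (Fin d → ℝ) × (Fin m → Fin d → ℝ) | LinearIndependent ℝ
        ((MeasurableEquiv.piFinSuccAbove (fun _ : Fin (m + 1) => Fin d → ℝ) 0).symm x)} :=
      h1.symm.measurable hopen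
    rw [← Measure.prod_swap, ae_map_iff measurable_swap.aemeasurable hopen2]
    refine (Measure.ae_prod_iff_ae_ae (measurable_swap hopen2)).2 ?_
    filter_upwards [ih (by omega)] with v hv
    have hne : Submodule.span ℝ (Set.range v) ≠ ⊤ := by
      intro h
      have := finrank_span_eq_card hv
      rw [h] at this
      simp at this
      omega
    have h0 := gaussianPi_ac d (Measure.addHaar_submodule volume _ hne)
    have h0' : ∀ᵐ x ∂(gaussianPi d), x ∉ Submodule.span ℝ (Set.range v) :=
      measure_eq_zero_iff_ae_notMem.1 h0
    filter_upwards [h0'] with x hx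
    have h7 : LinearIndependent ℝ (Fin.cons x v : Fin (m + 1) → Fin d → ℝ) :=
      (linearIndependent_finCons (v := v) (x := x)).2 ⟨hv, hx⟩
    have h8 : (MeasurableEquiv.piFinSuccAbove (fun _ : Fin (m + 1) => Fin d → ℝ) 0).symm
        (x, v) = (Fin.cons x v : Fin (m + 1) → Fin d → ℝ) := by
      ext a b
      simp [MeasurableEquiv.piFinSuccAbove, Fin.insertNthEquiv]
    rw [← h8] at h7
    exact h7

lemma map_precomp {ι κ X : Type*} [Fintype ι] [Fintype κ] [MeasurableSpace X] (ν : Measure X)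
    [IsProbabilityMeasure ν] (e : κ → ι) (he : Function.Injective e) :
    MeasurePreserving (fun (x : ι → X) a => x (e a))
      (Measure.pi fun _ => ν) (Measure.pi fun _ => ν) := by
  classical
  have hm : Measurable (fun (x : ι → X) (a : κ) => x (e a)) := by fun_prop
  refine ⟨hm, ?_⟩
  symm
  refine Measure.pi_eq fun t ht => ?_
  rw [Measure.map_apply hm (MeasurableSet.univ_pi ht)]
  have : (fun (x : ι → X) (a : κ) => x (e a)) ⁻¹' (Set.univ.pi t) =
      Set.univ.pi (Function.extend e t (fun _ => Set.univ)) := by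
    ext x
    simp only [Set.mem_preimage, Set.mem_pi, Set.mem_univ, true_imp_iff]
    constructor
    · intro h b
      by_cases hb : ∃ a, e a = b
      · obtain ⟨a, rfl⟩ := hb
        rw [he.extend_apply]; exact h a
      · rw [Function.extend_apply' _ _ _ hb]; trivial
    · intro h a
      have := h (e a)
      rwa [he.extend_apply] at this
  rw [this, Measure.pi_pi]
  rw [← Finset.prod_subset (Finset.subset_univ (Finset.univ.image e))]
  · rw [Finset.prod_image he.injOn]
    simp [he.extend_apply]
  · intro b _ hb
    rw [Function.extend_apply']
    · simp
    · simpa using hb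

lemma map_curry_aux (a b : ℕ) : MeasurePreserving (MeasurableEquiv.curry (Fin a) (Fin b) ℝ)
    (Measure.pi fun _ => gaussianReal 0 1) (Measure.pi fun _ : Fin a => gaussianPi b) := by
  refine ⟨MeasurableEquiv.measurable _, ?_⟩
  have := Measure.infinitePi_map_curry (fun (_ : Fin a) (_ : Fin b) => gaussianReal 0 1)
  simp only [Measure.infinitePi_eq_pi] at this
  exact this

lemma transport (n p i : ℕ) (h : i ≤ p) :
    MeasurePreserving (fun (ω : Fin p → Fin n → ℝ) (l : Fin n) (j : Fin i) => ω (Fin.castLE h j) l)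
      (Measure.pi fun _ => gaussianPi n) (Measure.pi fun _ => gaussianPi i) := by
  have h1 := (map_curry_aux p n).symm
  have h2 := map_curry_aux n i
  have h3 := map_precomp (gaussianReal 0 1)
    (fun q : Fin n × Fin i => (Fin.castLE h q.2, q.1)) (by
      rintro ⟨a, b⟩ ⟨c, d⟩ hh
      simp only [Prod.mk.injEq] at hh
      obtain ⟨h1, rfl⟩ := hh
      have := (Fin.castLE_injective h) h1
      simp [this])
  exact h2.comp (h3.comp h1)

lemma sphereLaw_eq (n p : ℕ) : sphereLaw n p =
    (Measure.pi fun _ : Fin p => gaussianPi n).map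
      (fun ω j => (euclidNorm (ω j))⁻¹ • ω j) := by
  have hm : Measurable fun x : Fin n → ℝ => (euclidNorm x)⁻¹ • x := by
    unfold euclidNorm; fun_prop
  have : IsProbabilityMeasure (Measure.map (fun x : Fin n → ℝ => (euclidNorm x)⁻¹ • x)
      (gaussianPi n)) := Measure.isProbabilityMeasure_map hm.aemeasurable
  unfold sphereLaw uniformSphere
  rw [Measure.pi_map_pi (fun _ => hm.aemeasurable)]

/-- Scaling the rows by nonzero numbers does not change the projection. -/
lemma proj_scale {m n : ℕ} (d : Fin m → ℝ) (hd : ∀ j, d j ≠ 0) (B : Matrix (Fin m) (Fin n) ℝ) :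
    (Matrix.diagonal d * B)ᵀ * ((Matrix.diagonal d * B) * (Matrix.diagonal d * B)ᵀ)⁻¹ *
      (Matrix.diagonal d * B) = Bᵀ * (B * Bᵀ)⁻¹ * B := by
  have hu : IsUnit (Matrix.diagonal d).det := by
    rw [Matrix.det_diagonal]
    exact (Finset.prod_ne_zero_iff.2 fun j _ => hd j).isUnit
  have h1 : (Matrix.diagonal d * B) * (Matrix.diagonal d * B)ᵀ =
      Matrix.diagonal d * (B * Bᵀ) * Matrix.diagonal d := by
    rw [Matrix.transpose_mul, Matrix.diagonal_transpose]
    simp only [Matrix.mul_assoc]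
  rw [h1, Matrix.mul_inv_rev, Matrix.mul_inv_rev, Matrix.transpose_mul, Matrix.diagonal_transpose]
  calc _ = Bᵀ * ((Matrix.diagonal d * (Matrix.diagonal d)⁻¹) * (B * Bᵀ)⁻¹ *
        ((Matrix.diagonal d)⁻¹ * Matrix.diagonal d)) * B := by
        simp only [Matrix.mul_assoc]
    _ = _ := by
        rw [Matrix.mul_nonsing_inv _ hu, Matrix.nonsing_inv_mul _ hu, Matrix.one_mul,
          Matrix.mul_one]

lemma euclidNorm_eq_zero {n : ℕ} {x : Fin n → ℝ} (h : euclidNorm x = 0) : x = 0 := by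
  unfold euclidNorm at h
  rw [Real.sqrt_eq_zero (Finset.sum_nonneg fun j _ => sq_nonneg _),
    Finset.sum_eq_zero_iff_of_nonneg (fun j _ => sq_nonneg _)] at h
  ext j
  simpa using h j (Finset.mem_univ _)

/-- The matrix with columns `A_{ll} w_l`. -/
def colMat {n i : ℕ} (A : Matrix (Fin n) (Fin n) ℝ) (w : Fin n → Fin i → ℝ) :
    Matrix (Fin i) (Fin n) ℝ := Matrix.of fun j l => A l l * w l j

lemma rowMat_eq {n p : ℕ} (A : Matrix (Fin n) (Fin n) ℝ) (hdiag : A.IsDiag)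
    (i : ℕ) (hi : i ≤ p) (ω : Fin p → Fin n → ℝ) :
    rowMat A ω i = colMat A (fun l (j : Fin i) => ω (Fin.castLE hi j) l) := by
  ext j l
  have hj : (j : ℕ) < p := lt_of_lt_of_le j.2 hi
  simp only [rowMat, colMat, Matrix.of_apply, uVec, hj, dif_pos, Matrix.mulVec, dotProduct]
  rw [Finset.sum_eq_single l]
  · rfl
  · intro b _ hb
    rw [hdiag hb.symm, zero_mul]
  · simp

lemma proj_normalized {n p : ℕ} (A : Matrix (Fin n) (Fin n) ℝ) (hdiag : A.IsDiag)
    (i : ℕ) (hi : i ≤ p) (ω : Fin p → Fin n → ℝ) :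
    projMat A (fun j => (euclidNorm (ω j))⁻¹ • ω j) i = projMat A ω i := by
  classical
  let d : Fin i → ℝ := fun j => if euclidNorm (ω (Fin.castLE hi j)) = 0 then 1 else
    (euclidNorm (ω (Fin.castLE hi j)))⁻¹
  have hd : ∀ j, d j ≠ 0 := by
    intro j
    simp only [d]
    split_ifs with h
    · exact one_ne_zero
    · exact inv_ne_zero h
  have : rowMat A (fun j => (euclidNorm (ω j))⁻¹ • ω j) i = Matrix.diagonal d * rowMat A ω i := by
    rw [rowMat_eq A hdiag i hi, rowMat_eq A hdiag i hi]
    ext j l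
    simp only [Matrix.diagonal_mul, colMat, Matrix.of_apply, Pi.smul_apply, smul_eq_mul, d]
    split_ifs with h
    · simp [euclidNorm_eq_zero h]
    · ring
  unfold projMat
  rw [this, proj_scale d hd]

lemma pointwise {n i : ℕ} (A : Matrix (Fin n) (Fin n) ℝ) (k : Fin n) (w : Fin n → Fin i → ℝ)
    (hS : (∑ l ∈ Finset.univ.erase k,
                (A l l) ^ 2 • Matrix.vecMulVec (w l) (w l)).PosDef) :
    (1 - (colMat A w)ᵀ * (colMat A w * (colMat A w)ᵀ)⁻¹ * colMat A w : Matrix (Fin n) (Fin n) ℝ) k k =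
      (1 + (A k k) ^ 2 *
            (w k ⬝ᵥ ((∑ l ∈ Finset.univ.erase k,
                (A l l) ^ 2 • Matrix.vecMulVec (w l) (w l))⁻¹).mulVec (w k)))⁻¹ := by
  have hM : colMat A w * (colMat A w)ᵀ = (∑ l ∈ Finset.univ.erase k,
                (A l l) ^ 2 • Matrix.vecMulVec (w l) (w l)) +
                (A k k) ^ 2 • Matrix.vecMulVec (w k) (w k) := by
    rw [Finset.sum_erase_add _ _ (Finset.mem_univ k)]
    ext a b
    simp only [Matrix.mul_apply, colMat, Matrix.of_apply, Matrix.transpose_apply,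
      Matrix.sum_apply, Matrix.smul_apply, Matrix.vecMulVec_apply, smul_eq_mul]
    exact Finset.sum_congr rfl fun l _ => by ring
  have hcol : ∀ j, colMat A w j k = A k k * w k j := fun j => rfl
  have hentry : ((colMat A w)ᵀ * (colMat A w * (colMat A w)ᵀ)⁻¹ * colMat A w) k k =
      (A k k) ^ 2 * (w k ⬝ᵥ ((colMat A w * (colMat A w)ᵀ)⁻¹).mulVec (w k)) := by
    rw [Matrix.mul_assoc]
    simp only [Matrix.mul_apply (M := (colMat A w)ᵀ),
      Matrix.mul_apply (M := (colMat A w * (colMat A w)ᵀ)⁻¹), Matrix.transpose_apply, hcol,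
      dotProduct, Matrix.mulVec, Finset.mul_sum]
    exact Finset.sum_congr rfl fun a _ => Finset.sum_congr rfl fun b _ => by ring
  rw [Matrix.sub_apply, Matrix.one_apply_eq, hentry, hM]
  set S := ∑ l ∈ Finset.univ.erase k, (A l l) ^ 2 • Matrix.vecMulVec (w l) (w l) with hSdef
  set q := w k ⬝ᵥ S⁻¹ *ᵥ (w k) with hq
  have hq0 : 0 ≤ q := by
    have := hS.inv.posSemidef.dotProduct_mulVec_nonneg (w k)
    simpa using this
  have hMp : (S + (A k k) ^ 2 • Matrix.vecMulVec (w k) (w k)).PosDef := by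
    refine hS.add_posSemidef ?_
    have := Matrix.posSemidef_vecMulVec_self_star (w k)
    exact Matrix.PosSemidef.smul (by simpa using this) (sq_nonneg _)
  set M := S + (A k k) ^ 2 • Matrix.vecMulVec (w k) (w k) with hMdef
  have hSu : IsUnit S.det := (Matrix.isUnit_iff_isUnit_det _).1 hS.isUnit
  have hMu : IsUnit M.det := (Matrix.isUnit_iff_isUnit_det _).1 hMp.isUnit
  have h1 : M *ᵥ (S⁻¹ *ᵥ w k) = (1 + (A k k) ^ 2 * q) • w k := by
    rw [hMdef, Matrix.add_mulVec, Matrix.mulVec_mulVec, Matrix.mul_nonsing_inv _ hSu,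
      Matrix.one_mulVec, Matrix.smul_mulVec, Matrix.vecMulVec_mulVec, ← hq, add_smul, one_smul]
    ext a
    simp
    ring
  have h2 : S⁻¹ *ᵥ w k = (1 + (A k k) ^ 2 * q) • (M⁻¹ *ᵥ w k) := by
    rw [← Matrix.mulVec_smul, ← h1, Matrix.mulVec_mulVec, Matrix.nonsing_inv_mul _ hMu,
      Matrix.one_mulVec]
  have h3 : q = (1 + (A k k) ^ 2 * q) * (w k ⬝ᵥ M⁻¹ *ᵥ w k) := by
    rw [← smul_eq_mul, ← dotProduct_smul, ← h2]
  have hpos : 0 < 1 + (A k k) ^ 2 * q := by positivity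
  refine eq_inv_of_mul_eq_one_left ?_
  linear_combination (A k k) ^ 2 * h3

lemma ae_posDef {n i : ℕ} (hi : i < n) (A : Matrix (Fin n) (Fin n) ℝ) (hpos : ∀ k, 0 < A k k)
    (k : Fin n) : ∀ᵐ w ∂(Measure.pi fun _ : Fin n => gaussianPi i),
      (∑ l ∈ Finset.univ.erase k, (A l l) ^ 2 • Matrix.vecMulVec (w l) (w l)).PosDef := by
  obtain ⟨m, rfl⟩ : ∃ m, n = m + 1 := ⟨n - 1, by omega⟩
  let f : Fin i → Fin (m + 1) := fun j => k.succAbove (Fin.castLE (by omega) j)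
  have hf : Function.Injective f :=
    Fin.succAbove_right_injective.comp (Fin.castLE_injective _)
  have hfk : ∀ j, f j ≠ k := fun j => Fin.succAbove_ne _ _
  have h := (map_precomp (gaussianPi i) f hf).quasiMeasurePreserving.ae
    (ae_linearIndependent_s13 i i le_rfl)
  filter_upwards [h] with w hw
  have hps : ∀ l, ((A l l) ^ 2 • Matrix.vecMulVec (w l) (w l)).PosSemidef := by
    intro l
    have := Matrix.posSemidef_vecMulVec_self_star (w l)
    exact Matrix.PosSemidef.smul (by simpa using this) (sq_nonneg _)
  have hq : ∀ x : Fin i → ℝ, x ⬝ᵥ ((∑ l ∈ Finset.univ.erase k,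
      (A l l) ^ 2 • Matrix.vecMulVec (w l) (w l)) *ᵥ x) =
      ∑ l ∈ Finset.univ.erase k, (A l l * (w l ⬝ᵥ x)) ^ 2 := by
    intro x
    rw [Matrix.sum_mulVec, dotProduct_sum]
    refine Finset.sum_congr rfl fun l _ => ?_
    rw [Matrix.smul_mulVec, Matrix.vecMulVec_mulVec, dotProduct_smul]
    rw [op_smul_eq_smul, dotProduct_smul, dotProduct_comm x]
    simp only [smul_eq_mul]
    ring
  refine Matrix.PosDef.of_dotProduct_mulVec_pos
    (Matrix.posSemidef_sum _ fun l _ => hps l).isHermitian fun x hx => ?_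
  rw [star_trivial, hq]
  refine lt_of_le_of_ne (Finset.sum_nonneg fun l _ => sq_nonneg _) fun h0 => hx ?_
  rw [eq_comm, Finset.sum_eq_zero_iff_of_nonneg (fun l _ => sq_nonneg _)] at h0
  have hz : (Matrix.of fun a => w (f a)) *ᵥ x = 0 := by
    ext j
    have := h0 (f j) (by simp [hfk])
    have h2 := pow_eq_zero_iff (two_ne_zero) |>.1 this
    exact (mul_eq_zero.1 h2).resolve_left (hpos _).ne'
  have hu : IsUnit (Matrix.of fun a => w (f a)) :=
    Matrix.linearIndependent_rows_iff_isUnit.1 hw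
  exact (Matrix.mulVec_injective_iff_isUnit.2 hu) (by rw [hz, Matrix.mulVec_zero])

/-- For a diagonal matrix `A` with positive diagonal and `1 ≤ i ≤ p−1 ≤ n−1`,
the expected diagonal entry of the projection matrix is
`E[p_{i,kk}] = E[1/(1 + A_{kk}² w_{ik}ᵀ (∑_{ℓ≠k} A_{ℓℓ}² w_{iℓ}w_{iℓ}ᵀ)⁻¹ w_{ik})]`,
where `w_{i1},…,w_{in}` are i.i.d. standard Gaussian vectors in `ℝ^i`. -/
theorem mean_proj_diag_entry {n p : ℕ} (hp : p ≤ n)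
    (A : Matrix (Fin n) (Fin n) ℝ) (hdiag : A.IsDiag) (hpos : ∀ k, 0 < A k k)
    (i : ℕ) (hi1 : 1 ≤ i) (hi2 : i < p) (k : Fin n) :
    (∫ ω, projMat A ω i k k ∂(sphereLaw n p)) =
      ∫ w : Fin n → Fin i → ℝ,
        (1 + (A k k) ^ 2 *
            (w k ⬝ᵥ ((∑ l ∈ Finset.univ.erase k,
                (A l l) ^ 2 • Matrix.vecMulVec (w l) (w l))⁻¹).mulVec (w k)))⁻¹
        ∂(Measure.pi fun _ : Fin n => gaussianPi i) := by
  have hip : i ≤ p := hi2.le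
  have hmeas : ∀ k, Measurable fun w : Fin n → Fin i → ℝ =>
      (1 - (colMat A w)ᵀ * (colMat A w * (colMat A w)ᵀ)⁻¹ * colMat A w : Matrix (Fin n) (Fin n) ℝ) k k := by
    intro k
    refine measurable_proj_aux _ ?_ k k
    intro j l
    simp only [colMat, Matrix.of_apply]
    fun_prop
  have hT := transport n p i hip
  have hproj : ∀ ω : Fin p → Fin n → ℝ, projMat A ω i k k =
      (fun w : Fin n → Fin i → ℝ =>
        (1 - (colMat A w)ᵀ * (colMat A w * (colMat A w)ᵀ)⁻¹ * colMat A w : Matrix (Fin n) (Fin n) ℝ) k k)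
        (fun l j => ω (Fin.castLE hip j) l) := by
    intro ω
    simp only [projMat, rowMat_eq A hdiag i hip]
  have hmp : Measurable fun ω : Fin p → Fin n → ℝ => projMat A ω i k k := by
    simp only [hproj]
    exact (hmeas k).comp hT.measurable
  have hm : Measurable fun (ω : Fin p → Fin n → ℝ) j => (euclidNorm (ω j))⁻¹ • ω j := by
    unfold euclidNorm; fun_prop
  rw [sphereLaw_eq, integral_map hm.aemeasurable hmp.aestronglyMeasurable]
  simp only [proj_normalized A hdiag i hip]
  simp only [hproj]
  rw [← integral_map (φ := fun (ω : Fin p → Fin n → ℝ) (l : Fin n) (j : Fin i) =>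
    ω (Fin.castLE hip j) l) hT.measurable.aemeasurable (hmeas k).aestronglyMeasurable, hT.map_eq]
  refine integral_congr_ae ?_
  filter_upwards [ae_posDef (lt_of_lt_of_le hi2 hp) A hpos k] with w hw
  exact pointwise A k w hw
end
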